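/- arXiv:1504.00079 — 11 statements merged into one kernel-verified Lean document; each statement's English description precedes it below -/
import Mathlib

section
/- For every real a > 0, the improper integral (2/π)∫₁^∞ sin(s a)(s² − 1)^{−1/2} ds converges (as the limit of ∫₁^R as R → ∞) and equals J₀(a), where J₀(a) = (1/π)∫₀^π cos(a sin t) dt is the Bessel function of order zero given by its standard integral representation. -/
open MeasureTheory Set Filter

/-- The substitution `s = cosh u` in an integral against `(s² - 1)^{-1/2}`. -/
theorem integral_div_sqrt_sq_sub_one_eq_integral_comp_cosh (g : ℝ → ℝ) {U : ℝ} (hU : 0 ≤ U) :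
    ∫ s in (1 : ℝ)..Real.cosh U, g s / Real.sqrt (s ^ 2 - 1) =
      ∫ u in (0 : ℝ)..U, g (Real.cosh u) := by
  have himage : Real.cosh '' Ioo 0 U = Ioo 1 (Real.cosh U) := by
    ext s
    constructor
    · rintro ⟨u, ⟨hu0, huU⟩, rfl⟩
      exact ⟨Real.one_lt_cosh.2 hu0.ne',
        Real.cosh_strictMonoOn hu0.le hU huU⟩
    · rintro ⟨hs1, hsU⟩
      refine ⟨Real.arcosh s, ⟨Real.arcosh_pos hs1, ?_⟩, Real.cosh_arcosh hs1.le⟩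
      rw [← Real.arcosh_cosh hU]
      exact (Real.arcosh_lt_arcosh (by linarith) (Real.cosh_pos U)).2 hsU
  rw [intervalIntegral.integral_of_le (Real.one_le_cosh U), intervalIntegral.integral_of_le hU,
    integral_Ioc_eq_integral_Ioo, integral_Ioc_eq_integral_Ioo, ← himage,
    integral_image_eq_integral_abs_deriv_smul measurableSet_Ioo
      (fun x _ => (Real.hasDerivAt_cosh x).hasDerivWithinAt)
      (Real.cosh_strictMonoOn.injOn.mono fun x hx => hx.1.le)]
  refine setIntegral_congr_fun measurableSet_Ioo fun u hu => ?_
  have hs : 0 < Real.sinh u := Real.sinh_pos_iff.2 hu.1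
  have hsq : Real.cosh u ^ 2 - 1 = Real.sinh u ^ 2 := by rw [Real.cosh_sq]; ring
  simp only [hsq, Real.sqrt_sq hs.le, abs_of_pos hs, smul_eq_mul]
  field_simp

theorem Complex.cosh_ofReal_add_ofReal_mul_I (x y : ℝ) :
    Complex.cosh (x + y * Complex.I) =
      ((Real.cosh x * Real.cos y : ℝ) : ℂ) + ((Real.sinh x * Real.sin y : ℝ) : ℂ) * Complex.I := by
  rw [Complex.cosh_add, Complex.cosh_mul_I, Complex.sinh_mul_I]
  push_cast
  ring

theorem Complex.exp_I_mul_cosh_eq (a x y : ℝ) :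
    Complex.exp (Complex.I * a * Complex.cosh (x + y * Complex.I)) =
      Complex.exp (((-(a * Real.sinh x * Real.sin y) : ℝ) : ℂ) +
        ((a * Real.cosh x * Real.cos y : ℝ) : ℂ) * Complex.I) := by
  rw [Complex.cosh_ofReal_add_ofReal_mul_I]
  congr 1
  push_cast
  linear_combination (a : ℂ) * Complex.sinh x * Complex.sin y * Complex.I_sq

/-- Cauchy's theorem for `exp (i a cosh w)` on the rectangle `[0, U] × [0, π / 2]`. -/
theorem integral_sin_mul_cosh_eq (a U : ℝ) :
    ∫ u in (0 : ℝ)..U, Real.sin (a * Real.cosh u) =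
      (∫ y in (0 : ℝ)..(Real.pi / 2), Real.cos (a * Real.cos y)) -
      ∫ y in (0 : ℝ)..(Real.pi / 2), Real.exp (-(a * Real.sinh U * Real.sin y)) *
        Real.cos (a * Real.cosh U * Real.cos y) := by
  set f : ℂ → ℂ := fun w => Complex.exp (Complex.I * a * Complex.cosh w) with hf
  have hdiff : Differentiable ℂ f := by
    rw [hf]
    fun_prop
  have hre (x y : ℝ) : (f (x + y * Complex.I)).re =
      Real.exp (-(a * Real.sinh x * Real.sin y)) * Real.cos (a * Real.cosh x * Real.cos y) := by
    simp only [hf, Complex.exp_I_mul_cosh_eq, Complex.exp_re, Complex.add_re, Complex.add_im,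
      Complex.ofReal_re, Complex.ofReal_im, Complex.re_ofReal_mul, Complex.im_ofReal_mul,
      Complex.I_re, Complex.I_im, mul_zero, mul_one, add_zero, zero_add]
  have him (x y : ℝ) : (f (x + y * Complex.I)).im =
      Real.exp (-(a * Real.sinh x * Real.sin y)) * Real.sin (a * Real.cosh x * Real.cos y) := by
    simp only [hf, Complex.exp_I_mul_cosh_eq, Complex.exp_im, Complex.add_re, Complex.add_im,
      Complex.ofReal_re, Complex.ofReal_im, Complex.re_ofReal_mul, Complex.im_ofReal_mul,
      Complex.I_re, Complex.I_im, mul_zero, mul_one, add_zero, zero_add]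
  have hx (y p q : ℝ) : (∫ x in p..q, f (x + y * Complex.I)).im =
      ∫ x in p..q, (f (x + y * Complex.I)).im :=
    (Complex.imCLM.intervalIntegral_comp_comm
      ((hdiff.continuous.comp (by fun_prop)).intervalIntegrable p q)).symm
  have hy (x p q : ℝ) : (∫ y : ℝ in p..q, f (x + y * Complex.I)).re =
      ∫ y : ℝ in p..q, (f (x + y * Complex.I)).re :=
    (Complex.reCLM.intervalIntegral_comp_comm
      ((hdiff.continuous.comp (by fun_prop)).intervalIntegrable p q)).symm
  have hrect := congrArg Complex.im
    (Complex.integral_boundary_rect_eq_zero_of_differentiableOn f ((0 : ℝ) + (0 : ℝ) * Complex.I)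
      (U + (Real.pi / 2 : ℝ) * Complex.I) hdiff.differentiableOn)
  simp only [Complex.add_re, Complex.add_im, Complex.ofReal_re, Complex.ofReal_im,
    Complex.re_ofReal_mul, Complex.im_ofReal_mul, Complex.I_re, Complex.I_im, mul_zero, mul_one,
    add_zero, zero_add, Complex.sub_im, smul_eq_mul, Complex.I_mul_im, hx, hy, hre, him,
    Complex.zero_im, Real.sin_zero, Real.cos_zero, Real.sinh_zero, Real.cosh_zero,
    Real.cos_pi_div_two, neg_zero, Real.exp_zero, one_mul, zero_mul,
    intervalIntegral.integral_zero, sub_zero] at hrect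
  linarith

theorem tendsto_integral_exp_neg_sinh_mul_sin {a : ℝ} (ha : 0 < a) :
    Tendsto (fun U : ℝ => ∫ y in (0 : ℝ)..(Real.pi / 2),
      Real.exp (-(a * Real.sinh U * Real.sin y)) * Real.cos (a * Real.cosh U * Real.cos y))
      atTop (nhds 0) := by
  have hsinh : Tendsto Real.sinh atTop atTop :=
    tendsto_atTop_mono' atTop
      ((eventually_ge_atTop 0).mono fun _ hx => Real.self_le_sinh_iff.2 hx) tendsto_id
  have hsin : ∀ y ∈ uIoc 0 (Real.pi / 2), 0 < Real.sin y := fun y hy => by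
    rw [uIoc_of_le (by positivity)] at hy
    exact Real.sin_pos_of_pos_of_lt_pi hy.1 (by linarith [hy.2, Real.pi_pos])
  have hbound (U y : ℝ) : ‖Real.exp (-(a * Real.sinh U * Real.sin y)) *
      Real.cos (a * Real.cosh U * Real.cos y)‖ ≤ Real.exp (-(a * Real.sinh U * Real.sin y)) := by
    rw [norm_mul, Real.norm_eq_abs, Real.abs_exp]
    exact mul_le_of_le_one_right (Real.exp_pos _).le (Real.abs_cos_le_one _)
  have := intervalIntegral.tendsto_integral_filter_of_dominated_convergence (μ := volume)
    (a := 0) (b := Real.pi / 2) (l := atTop) (f := fun _ => (0 : ℝ))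
    (F := fun U y => Real.exp (-(a * Real.sinh U * Real.sin y)) *
      Real.cos (a * Real.cosh U * Real.cos y)) (fun _ => 1)
    (Eventually.of_forall fun U => Continuous.aestronglyMeasurable (by fun_prop))
    ((eventually_ge_atTop 0).mono fun U hU => ae_of_all _ fun y hy => by
      refine (hbound U y).trans (Real.exp_le_one_iff.2 (neg_nonpos.2 ?_))
      exact mul_nonneg (mul_nonneg ha.le (Real.sinh_nonneg_iff.2 hU)) (hsin y hy).le)
    intervalIntegrable_const
    (ae_of_all _ fun y hy => squeeze_zero_norm (hbound · y)
      (Real.tendsto_exp_neg_atTop_nhds_zero.comp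
        ((hsinh.const_mul_atTop ha).atTop_mul_const (hsin y hy))))
  simpa using this

theorem integral_cos_mul_sin_eq_two_mul (a : ℝ) :
    ∫ t in (0 : ℝ)..Real.pi, Real.cos (a * Real.sin t) =
      2 * ∫ y in (0 : ℝ)..(Real.pi / 2), Real.cos (a * Real.cos y) := by
  have hint (p q : ℝ) :
      IntervalIntegrable (fun t => Real.cos (a * Real.sin t)) volume p q :=
    Continuous.intervalIntegrable (by fun_prop) p q
  have h₁ := intervalIntegral.integral_comp_sub_left (a := 0) (b := Real.pi / 2)
    (fun t => Real.cos (a * Real.sin t)) (Real.pi / 2)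
  have h₂ := intervalIntegral.integral_comp_add_right (a := 0) (b := Real.pi / 2)
    (fun t => Real.cos (a * Real.sin t)) (Real.pi / 2)
  simp only [Real.sin_pi_div_two_sub, sub_self, sub_zero] at h₁
  simp only [Real.sin_add_pi_div_two, zero_add, add_halves] at h₂
  rw [← intervalIntegral.integral_add_adjacent_intervals (hint 0 (Real.pi / 2)) (hint _ _),
    ← h₁, ← h₂]
  ring

theorem Real.tendsto_arcosh_atTop : Tendsto Real.arcosh atTop atTop := by
  refine tendsto_atTop.2 fun b => (eventually_ge_atTop (Real.cosh |b|)).mono fun R hR => ?_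
  have hpos := Real.cosh_pos |b|
  calc b ≤ |b| := le_abs_self b
    _ = Real.arcosh (Real.cosh |b|) := (Real.arcosh_cosh (abs_nonneg b)).symm
    _ ≤ Real.arcosh R := (Real.arcosh_le_arcosh hpos (hpos.trans_le hR)).2 hR

/-- For `a > 0`, the improper integral `(2/π)∫₁^∞ sin(s a)(s² − 1)^{−1/2} ds` converges and
equals the Bessel function `J₀(a) = (1/π)∫₀^π cos(a sin t) dt`. -/
theorem bessel_J0_improper_integral (a : ℝ) (ha : 0 < a) :
    Tendsto
      (fun R : ℝ => (2 / Real.pi) * ∫ s in (1 : ℝ)..R, Real.sin (s * a) / Real.sqrt (s ^ 2 - 1))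
      atTop
      (nhds ((1 / Real.pi) * ∫ t in (0 : ℝ)..Real.pi, Real.cos (a * Real.sin t))) := by
  have hlim := ((tendsto_integral_exp_neg_sinh_mul_sin ha).const_sub
    (∫ y in (0 : ℝ)..(Real.pi / 2), Real.cos (a * Real.cos y))).const_mul (2 / Real.pi)
  convert (hlim.comp Real.tendsto_arcosh_atTop).congr' ?_ using 2
  · rw [integral_cos_mul_sin_eq_two_mul]
    ring
  · filter_upwards [eventually_ge_atTop 1] with R hR
    have hsub := integral_div_sqrt_sq_sub_one_eq_integral_comp_cosh (fun s => Real.sin (s * a))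
      (Real.arcosh_nonneg hR)
    rw [Real.cosh_arcosh hR] at hsub
    rw [Function.comp_apply, hsub, ← integral_sin_mul_cosh_eq]
    simp only [mul_comm _ a]
end

section
/- Let φ : [0,1] → ℝ be a smooth function with φ'(0) = 0, φ''(0) ≠ 0, and φ'(s) ≠ 0 for every s ∈ (0,1], and let a : [0,1] → ℂ be continuously differentiable. Then there exists a constant C (depending on φ and a) such that for all μ ≥ 1, |∫₀¹ e^{iμφ(s)} a(s) ds| ≤ C μ^{−1/2}. -/
open MeasureTheory Set Filter

/-- A function on `[0,1]` whose only zero is a simple zero at `0` is bounded below by a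
multiple of `s`. -/
lemma exists_pos_mul_le_abs_of_simple_zero {f : ℝ → ℝ} {f' : ℝ}
    (hf : ContinuousOn f (Icc 0 1)) (hf' : HasDerivWithinAt f f' (Icc 0 1) 0) (h0 : f 0 = 0)
    (hne : f' ≠ 0) (hpos : ∀ s ∈ Ioc (0 : ℝ) 1, f s ≠ 0) :
    ∃ m > 0, ∀ s ∈ Icc (0 : ℝ) 1, m * s ≤ |f s| := by
  have hcont : ContinuousOn (Function.update (slope f 0) 0 f') (Icc 0 1) := by
    refine continuousOn_update_iff.2 ⟨?_, fun _ => hasDerivWithinAt_iff_tendsto_slope.1 hf'⟩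
    refine ContinuousOn.congr (f := fun s => f s / s) ?_ fun s _ => by
      simp [slope_def_field, h0]
    exact (hf.mono sdiff_subset).div continuousOn_id fun s hs => hs.2
  obtain ⟨t, ht, hmin⟩ := isCompact_Icc.exists_isMinOn (nonempty_Icc.2 zero_le_one) hcont.abs
  refine ⟨|Function.update (slope f 0) 0 f' t|, abs_pos.2 ?_, fun s hs => ?_⟩
  · rcases eq_or_ne t 0 with rfl | hne'
    · simpa using hne
    · simpa [hne', slope_def_field, h0] using hpos t ⟨lt_of_le_of_ne ht.1 hne'.symm, ht.2⟩
  · rcases eq_or_ne s 0 with rfl | hs0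
    · simp
    · have hs' : 0 < s := lt_of_le_of_ne hs.1 hs0.symm
      have := isMinOn_iff.1 hmin s hs
      rw [Function.update_of_ne hs0, slope_def_field, h0, sub_zero, sub_zero, abs_div,
        abs_of_pos hs', le_div_iff₀ hs'] at this
      exact this

lemma continuousOn_const_div_sq {ε : ℝ} (hε : 0 < ε) (K : ℝ) :
    ContinuousOn (fun s : ℝ => K / s ^ 2) (uIcc ε 1) := by
  refine continuousOn_const.div (by fun_prop) fun s hs => ?_
  have : 0 < s := (lt_min hε one_pos).trans_le hs.1
  positivity

lemma integral_const_div_sq {ε : ℝ} (hε : 0 < ε) (K : ℝ) :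
    ∫ s in ε..1, K / s ^ 2 = K / ε - K := by
  rw [intervalIntegral.integral_eq_sub_of_hasDerivAt (f := fun s => -(K / s)) (fun s hs => ?_)
    (continuousOn_const_div_sq hε K).intervalIntegrable]
  · ring
  · have : 0 < s := (lt_min hε one_pos).trans_le hs.1
    refine ((hasDerivAt_const s K).div (hasDerivAt_id s) this.ne').neg.congr_deriv ?_
    simp [neg_div]

lemma norm_exp_I_mul_ofReal_mul_ofReal (μ x : ℝ) :
    ‖Complex.exp (Complex.I * (μ : ℂ) * (x : ℂ))‖ = 1 := by
  rw [mul_assoc, mul_comm, ← Complex.ofReal_mul]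
  exact Complex.norm_exp_ofReal_mul_I _

/-- Nonstationary phase estimate on `[ε,1]` when `|φ'(s)| ≥ m s`, by one integration by parts. -/
lemma norm_integral_exp_mul_le_of_mul_le_abs_deriv {φ g h : ℝ → ℝ} {a b : ℝ → ℂ}
    {m A B H μ ε : ℝ}
    (hφ : ∀ s ∈ Icc (0 : ℝ) 1, HasDerivWithinAt φ (g s) (Icc 0 1) s)
    (hg : ∀ s ∈ Icc (0 : ℝ) 1, HasDerivWithinAt g (h s) (Icc 0 1) s)
    (hh : ContinuousOn h (Icc 0 1))
    (ha : ∀ s ∈ Icc (0 : ℝ) 1, HasDerivWithinAt a (b s) (Icc 0 1) s)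
    (hb : ContinuousOn b (Icc 0 1))
    (hm : 0 < m) (hmg : ∀ s ∈ Icc (0 : ℝ) 1, m * s ≤ |g s|)
    (hA : ∀ s ∈ Icc (0 : ℝ) 1, ‖a s‖ ≤ A) (hB : ∀ s ∈ Icc (0 : ℝ) 1, ‖b s‖ ≤ B)
    (hH : ∀ s ∈ Icc (0 : ℝ) 1, ‖h s‖ ≤ H) (hμ : 0 < μ) (hε : 0 < ε) (hε1 : ε ≤ 1) :
    μ * ‖∫ s in ε..1, Complex.exp (Complex.I * (μ : ℂ) * (φ s : ℂ)) * a s‖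
      ≤ (2 * A / m + (B / m + A * H / m ^ 2)) / ε := by
  have hsub : Icc ε 1 ⊆ Icc (0 : ℝ) 1 := Icc_subset_Icc_left hε.le
  have hA0 : 0 ≤ A := (norm_nonneg _).trans (hA 1 (by simp))
  have hB0 : 0 ≤ B := (norm_nonneg _).trans (hB 1 (by simp))
  have hH0 : 0 ≤ H := (norm_nonneg _).trans (hH 1 (by simp))
  set e : ℝ → ℂ := fun s => Complex.exp (Complex.I * (μ : ℂ) * (φ s : ℂ)) with he
  have he1 : ∀ s, ‖e s‖ = 1 := fun s => norm_exp_I_mul_ofReal_mul_ofReal μ (φ s)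
  set u : ℝ → ℂ := fun s => a s / (g s : ℂ) with hu
  set v : ℝ → ℂ := fun s => (b s * (g s : ℂ) - a s * (h s : ℂ)) / (g s : ℂ) ^ 2 with hv
  set K : ℝ := B / m + A * H / m ^ 2 with hK
  have hK0 : 0 ≤ K := by positivity
  have hg0 : ∀ s ∈ Icc ε 1, (g s : ℂ) ≠ 0 := fun s hs => by
    have h1 := hmg s (hsub hs)
    have h2 : 0 < m * s := mul_pos hm (hε.trans_le hs.1)
    exact_mod_cast abs_pos.1 (h2.trans_le h1)
  have hφc : ContinuousOn φ (Icc ε 1) := fun s hs => (hφ s (hsub hs)).continuousWithinAt.mono hsub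
  have hgc : ContinuousOn (fun s => (g s : ℂ)) (Icc ε 1) :=
    Complex.continuous_ofReal.comp_continuousOn
      fun s hs => (hg s (hsub hs)).continuousWithinAt.mono hsub
  have hhc : ContinuousOn (fun s => (h s : ℂ)) (Icc ε 1) :=
    Complex.continuous_ofReal.comp_continuousOn (hh.mono hsub)
  have hac : ContinuousOn a (Icc ε 1) := fun s hs => (ha s (hsub hs)).continuousWithinAt.mono hsub
  have hec : ContinuousOn e (Icc ε 1) := Complex.continuous_exp.comp_continuousOn
    (continuousOn_const.mul (Complex.continuous_ofReal.comp_continuousOn hφc))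
  have huc : ContinuousOn u (Icc ε 1) := hac.div hgc hg0
  have hvc : ContinuousOn v (Icc ε 1) :=
    (((hb.mono hsub).mul hgc).sub (hac.mul hhc)).div (hgc.pow 2) fun s hs => pow_ne_zero _ (hg0 s hs)
  have hveI : IntervalIntegrable (fun s => v s * e s) volume ε 1 :=
    ContinuousOn.intervalIntegrable_of_Icc hε1 (hvc.mul hec)
  have heaI : IntervalIntegrable (fun s => Complex.I * (μ : ℂ) * (e s * a s)) volume ε 1 :=
    ContinuousOn.intervalIntegrable_of_Icc hε1 (continuousOn_const.mul (hec.mul hac))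
  have hderiv : ∀ s ∈ Ioo ε 1, HasDerivAt (fun s => u s * e s)
      (v s * e s + Complex.I * (μ : ℂ) * (e s * a s)) s := fun s hs => by
    have hsI : s ∈ Icc ε 1 := Ioo_subset_Icc_self hs
    have hnhds : Icc (0 : ℝ) 1 ∈ nhds s := Icc_mem_nhds (hε.trans hs.1) hs.2
    have dφ := ((hφ s (hsub hsI)).hasDerivAt hnhds).ofReal_comp
    have dg := ((hg s (hsub hsI)).hasDerivAt hnhds).ofReal_comp
    have da := (ha s (hsub hsI)).hasDerivAt hnhds
    refine ((da.div dg (hg0 s hsI)).mul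
      (dφ.const_mul (Complex.I * (μ : ℂ))).cexp).congr_deriv ?_
    have := hg0 s hsI
    simp only [hv, he, Pi.div_apply]
    field_simp
  have hparts := intervalIntegral.integral_eq_sub_of_hasDerivAt_of_le hε1 (huc.mul hec) hderiv
    (hveI.add heaI)
  rw [intervalIntegral.integral_add hveI heaI, intervalIntegral.integral_const_mul] at hparts
  change _ = u 1 * e 1 - u ε * e ε at hparts
  have hub : ∀ s ∈ Icc ε 1, ‖u s‖ ≤ A / m / ε := fun s hs => by
    rw [hu, norm_div, Complex.norm_real, Real.norm_eq_abs, div_div]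
    have : m * ε ≤ |g s| :=
      (mul_le_mul_of_nonneg_left hs.1 hm.le).trans (hmg s (hsub hs))
    exact div_le_div₀ hA0 (hA s (hsub hs)) (mul_pos hm hε) this
  have hvb : ∀ s ∈ Icc ε 1, ‖v s‖ ≤ K / s ^ 2 := fun s hs => by
    have hs0 : 0 < s := hε.trans_le hs.1
    have hgs := hmg s (hsub hs)
    have hvs : v s = b s / (g s : ℂ) - a s * (h s : ℂ) / (g s : ℂ) ^ 2 := by
      have := hg0 s hs
      simp only [hv]
      field_simp
    rw [hvs]
    refine (norm_sub_le _ _).trans ?_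
    rw [norm_div, norm_div, norm_mul, norm_pow, Complex.norm_real, Complex.norm_real,
      Real.norm_eq_abs (g s)]
    have h1 : ‖b s‖ / |g s| ≤ B / (m * s) :=
      div_le_div₀ hB0 (hB s (hsub hs)) (by positivity) hgs
    have h2 : ‖a s‖ * ‖h s‖ / |g s| ^ 2 ≤ A * H / (m * s) ^ 2 :=
      div_le_div₀ (by positivity)
        (mul_le_mul (hA s (hsub hs)) (hH s (hsub hs)) (norm_nonneg _) hA0) (by positivity)
        (pow_le_pow_left₀ (by positivity) hgs 2)
    have h3 : B / (m * s) ≤ B / (m * s ^ 2) := by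
      have : s ^ 2 ≤ s := by nlinarith [hs.2]
      gcongr
    calc _ ≤ B / (m * s ^ 2) + A * H / (m * s) ^ 2 := add_le_add (h1.trans h3) h2
      _ = K / s ^ 2 := by rw [hK]; field_simp
  have hvi : ‖∫ s in ε..1, v s * e s‖ ≤ K / ε := by
    refine (intervalIntegral.norm_integral_le_of_norm_le hε1 (g := fun s => K / s ^ 2)
      (Eventually.of_forall fun s hs => ?_)
      (continuousOn_const_div_sq hε K).intervalIntegrable).trans ?_
    · rw [norm_mul, he1, mul_one]
      exact hvb s (Ioc_subset_Icc_self hs)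
    · rw [integral_const_div_sq hε]
      linarith
  have hI : μ * ‖∫ s in ε..1, e s * a s‖ = ‖u 1 * e 1 - u ε * e ε - ∫ s in ε..1, v s * e s‖ := by
    rw [← eq_sub_of_add_eq' hparts, norm_mul, norm_mul, Complex.norm_I, one_mul,
      Complex.norm_real, Real.norm_of_nonneg hμ.le]
  rw [hI]
  have hu1 := hub 1 ⟨hε1, le_rfl⟩
  have huε := hub ε ⟨le_rfl, hε1⟩
  calc _ ≤ ‖u 1‖ + ‖u ε‖ + ‖∫ s in ε..1, v s * e s‖ := by
        refine (norm_sub_le _ _).trans (add_le_add_left ((norm_sub_le _ _).trans ?_) _)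
        simp [he1]
    _ ≤ A / m / ε + A / m / ε + K / ε := add_le_add (add_le_add hu1 huε) hvi
    _ = _ := by ring



/-- Stationary phase for a smooth phase on `[0,1]` with a single nondegenerate critical point
at the left endpoint `s = 0`, with a `C¹` amplitude. -/
theorem stationary_phase_endpoint
    (φ : ℝ → ℝ) (hφ : ContDiffOn ℝ (⊤ : ℕ∞) φ (Set.Icc 0 1))
    (hφ'0 : derivWithin φ (Set.Icc 0 1) 0 = 0)
    (hφ''0 : derivWithin (derivWithin φ (Set.Icc 0 1)) (Set.Icc 0 1) 0 ≠ 0)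
    (hφ' : ∀ s ∈ Set.Ioc (0 : ℝ) 1, derivWithin φ (Set.Icc 0 1) s ≠ 0)
    (a : ℝ → ℂ) (ha : ContDiffOn ℝ 1 a (Set.Icc 0 1)) :
    ∃ C : ℝ, ∀ μ : ℝ, 1 ≤ μ →
      ‖∫ s in (0 : ℝ)..1, Complex.exp (Complex.I * (μ : ℂ) * (φ s : ℂ)) * a s‖
        ≤ C * μ ^ (-(1/2) : ℝ) := by
  have hI : UniqueDiffOn ℝ (Icc (0 : ℝ) 1) := uniqueDiffOn_Icc zero_lt_one
  set g := derivWithin φ (Icc 0 1) with hg_def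
  have hg : ContDiffOn ℝ (⊤ : ℕ∞) g (Icc 0 1) := hφ.derivWithin hI (by simp)
  have hh : ContinuousOn (derivWithin g (Icc 0 1)) (Icc 0 1) :=
    hg.continuousOn_derivWithin hI (by simp)
  have hb : ContinuousOn (derivWithin a (Icc 0 1)) (Icc 0 1) :=
    ha.continuousOn_derivWithin hI le_rfl
  have dφ : ∀ s ∈ Icc (0 : ℝ) 1, HasDerivWithinAt φ (g s) (Icc 0 1) s := fun s hs =>
    (hφ.differentiableOn (by simp) s hs).hasDerivWithinAt
  have dg : ∀ s ∈ Icc (0 : ℝ) 1, HasDerivWithinAt g (derivWithin g (Icc 0 1) s) (Icc 0 1) s :=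
    fun s hs => (hg.differentiableOn (by simp) s hs).hasDerivWithinAt
  have da : ∀ s ∈ Icc (0 : ℝ) 1, HasDerivWithinAt a (derivWithin a (Icc 0 1) s) (Icc 0 1) s :=
    fun s hs => (ha.differentiableOn (by simp) s hs).hasDerivWithinAt
  obtain ⟨m, hm, hmg⟩ := exists_pos_mul_le_abs_of_simple_zero hg.continuousOn (dg 0 (by simp))
    hφ'0 hφ''0 hφ'
  obtain ⟨A, hA⟩ := isCompact_Icc.exists_bound_of_continuousOn ha.continuousOn
  obtain ⟨B, hB⟩ := isCompact_Icc.exists_bound_of_continuousOn hb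
  obtain ⟨H, hH⟩ := isCompact_Icc.exists_bound_of_continuousOn hh
  refine ⟨A + (2 * A / m + (B / m + A * H / m ^ 2)), fun μ hμ => ?_⟩
  have hμ0 : 0 < μ := one_pos.trans_le hμ
  set ε : ℝ := μ ^ (-(1 / 2) : ℝ) with hε_def
  have hε : 0 < ε := Real.rpow_pos_of_pos hμ0 _
  have hε1 : ε ≤ 1 := Real.rpow_le_one_of_one_le_of_nonpos hμ (by norm_num)
  have hμε : μ * (ε * ε) = 1 := by
    rw [hε_def, ← Real.rpow_add hμ0]
    norm_num [Real.rpow_neg_one, hμ0.ne']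
  have hcont : ContinuousOn
      (fun s => Complex.exp (Complex.I * (μ : ℂ) * (φ s : ℂ)) * a s) (Icc 0 1) :=
    (Complex.continuous_exp.comp_continuousOn (continuousOn_const.mul
      (Complex.continuous_ofReal.comp_continuousOn hφ.continuousOn))).mul ha.continuousOn
  have hnear : ‖∫ s in (0 : ℝ)..ε, Complex.exp (Complex.I * (μ : ℂ) * (φ s : ℂ)) * a s‖
      ≤ A * ε := by
    have := intervalIntegral.norm_integral_le_of_norm_le_const (a := 0) (b := ε) (C := A)
      (f := fun s => Complex.exp (Complex.I * (μ : ℂ) * (φ s : ℂ)) * a s) fun s hs => by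
        rw [uIoc_of_le hε.le] at hs
        rw [norm_mul, norm_exp_I_mul_ofReal_mul_ofReal, one_mul]
        exact hA s ⟨hs.1.le, hs.2.trans hε1⟩
    rwa [sub_zero, abs_of_pos hε] at this
  have hfar := norm_integral_exp_mul_le_of_mul_le_abs_deriv dφ dg hh da hb hm hmg hA hB hH
    hμ0 hε hε1
  rw [← intervalIntegral.integral_add_adjacent_intervals
    (ContinuousOn.intervalIntegrable_of_Icc hε.le (hcont.mono (Icc_subset_Icc_right hε1)))
    (ContinuousOn.intervalIntegrable_of_Icc hε1 (hcont.mono (Icc_subset_Icc_left hε.le))), add_mul]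
  refine (norm_add_le _ _).trans (add_le_add hnear ?_)
  refine le_of_mul_le_mul_left (hfar.trans_eq ?_) hμ0
  rw [div_eq_iff hε.ne']
  linear_combination -(2 * A / m + (B / m + A * H / m ^ 2)) * hμε
end

section
/- Fix ρ ≥ 1 and 1 < q ≤ 2. There is a constant C = C(ρ,q) such that for every s > 0, the quantity (∫₀^{2πρ} |sin(θ/ρ) / (cosh(s/ρ) − cos(θ/ρ))|^q dθ)^{1/q} is at most C s^{(1/q) − 1} when 0 < s < 1, and at most C e^{−s/ρ} when s ≥ 1. -/
open MeasureTheory Set Filter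

lemma one_sub_exp_neg_sq_le_cosh_sub_cos {b a : ℝ} (hb : 0 < b) (hba : b ≤ a) (x : ℝ) :
    Real.exp a * ((1 - Real.exp (-b)) ^ 2 / 2) ≤ Real.cosh a - Real.cos x := by
  have h1 : Real.exp (-a) ≤ Real.exp (-b) := Real.exp_le_exp.2 (by linarith)
  have h2 : Real.exp (-b) < 1 := Real.exp_lt_one_iff.2 (by linarith)
  have h3 : (1 - Real.exp (-b)) ^ 2 ≤ (1 - Real.exp (-a)) ^ 2 :=
    pow_le_pow_left₀ (by linarith) (by linarith) 2
  have h4 : Real.exp a * Real.exp (-a) = 1 := by rw [← Real.exp_add]; simp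
  have h5 := mul_le_mul_of_nonneg_left h3 (Real.exp_pos a).le
  have h6 : Real.exp a * (1 - Real.exp (-a)) ^ 2
      = Real.exp a - 2 + Real.exp (-a) := by
    linear_combination (-2 + Real.exp (-a)) * h4
  have h7 := Real.cos_le_one x
  rw [Real.cosh_eq]
  linarith

lemma abs_sin_div_cosh_sub_cos_le_exp {b a : ℝ} (hb : 0 < b) (hba : b ≤ a) (x : ℝ) :
    |Real.sin x / (Real.cosh a - Real.cos x)|
      ≤ 2 / (1 - Real.exp (-b)) ^ 2 * Real.exp (-a) := by
  have h2 : 0 < 1 - Real.exp (-b) := by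
    have : Real.exp (-b) < 1 := Real.exp_lt_one_iff.2 (by linarith)
    linarith
  have hd := one_sub_exp_neg_sq_le_cosh_sub_cos hb hba x
  have hm : 0 < Real.exp a * ((1 - Real.exp (-b)) ^ 2 / 2) := by positivity
  rw [abs_div, abs_of_pos (hm.trans_le hd)]
  calc |Real.sin x| / (Real.cosh a - Real.cos x)
      ≤ 1 / (Real.exp a * ((1 - Real.exp (-b)) ^ 2 / 2)) :=
        div_le_div₀ zero_le_one (Real.abs_sin_le_one x) hm hd
    _ = _ := by rw [Real.exp_neg a]; field_simp

lemma abs_sin_div_cosh_sub_cos_le {a x : ℝ} (ha : 0 < a) (hx : 0 ≤ x) (hxπ : x ≤ Real.pi) :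
    |Real.sin x / (Real.cosh a - Real.cos x)| ≤ Real.pi ^ 2 / (a + x) := by
  have hπ := Real.pi_gt_three
  have hc := Real.cos_le_one_sub_mul_cos_sq (x := x) (by rwa [abs_of_nonneg hx])
  have hcosh : 1 + a ^ 2 / 2 ≤ Real.cosh a := by
    have h1 : a / 2 ≤ Real.sinh (a / 2) := Real.self_le_sinh_iff.2 (by positivity)
    have h2 := pow_le_pow_left₀ (by positivity) h1 2
    have h3 := Real.cosh_two_mul (a / 2)
    rw [mul_div_cancel₀ a two_ne_zero, Real.cosh_sq] at h3
    linarith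
  have hsin : |Real.sin x| ≤ x := by
    simpa [abs_of_nonneg hx] using Real.abs_sin_le_abs (x := x)
  have h1 : 2 / Real.pi ^ 2 ≤ 1 / 2 := by
    rw [div_le_div_iff₀ (by positivity) (by norm_num)]
    nlinarith
  have hd : (a + x) ^ 2 / Real.pi ^ 2 ≤ Real.cosh a - Real.cos x := by
    have e : (a + x) ^ 2 / Real.pi ^ 2 ≤ 2 / Real.pi ^ 2 * (a ^ 2 + x ^ 2) := by
      rw [div_mul_eq_mul_div]
      gcongr
      nlinarith [sq_nonneg (a - x)]
    nlinarith [mul_le_mul_of_nonneg_right h1 (sq_nonneg a)]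
  have hm : 0 < (a + x) ^ 2 / Real.pi ^ 2 := by positivity
  rw [abs_div, abs_of_pos (hm.trans_le hd)]
  calc |Real.sin x| / (Real.cosh a - Real.cos x)
      ≤ (a + x) / ((a + x) ^ 2 / Real.pi ^ 2) :=
        div_le_div₀ (by positivity) (by linarith) hm hd
    _ = _ := by field_simp

lemma intervalIntegrable_add_rpow {s L : ℝ} (r : ℝ) (hs : 0 < s) (hL : 0 ≤ L) :
    IntervalIntegrable (fun θ : ℝ => (s + θ) ^ r) volume 0 L := by
  apply ContinuousOn.intervalIntegrable
  intro θ hθ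
  rw [uIcc_of_le hL] at hθ
  have : s + θ ≠ 0 := by linarith [hθ.1]
  exact (ContinuousAt.rpow_const (by fun_prop) (Or.inl this)).continuousWithinAt

lemma integral_add_rpow_neg_le {s L q : ℝ} (hs : 0 < s) (hL : 0 ≤ L) (hq : 1 < q) :
    ∫ θ in (0 : ℝ)..L, (s + θ) ^ (-q) ≤ s ^ (1 - q) / (q - 1) := by
  have hmem : (0 : ℝ) ∉ uIcc s (s + L) := by
    rw [uIcc_of_le (by linarith)]
    exact fun h => absurd h.1 (by linarith)
  rw [intervalIntegral.integral_comp_add_left (fun x : ℝ => x ^ (-q)), add_zero,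
    integral_rpow (Or.inr ⟨by linarith, hmem⟩), show -q + 1 = -(q - 1) by ring,
    show 1 - q = -(q - 1) by ring, div_neg, ← neg_div]
  have : 0 ≤ (s + L) ^ (-(q - 1)) := by positivity
  gcongr
  linarith

lemma abs_kernel_rpow_le {ρ q s θ : ℝ} (hρ : 0 < ρ) (hq : 0 ≤ q) (hs : 0 < s) (hθ : 0 ≤ θ)
    (hθ' : θ ≤ 2 * Real.pi * ρ) :
    |Real.sin (θ / ρ) / (Real.cosh (s / ρ) - Real.cos (θ / ρ))| ^ q
      ≤ (Real.pi ^ 2 * ρ) ^ q *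
        ((s + θ) ^ (-q) + (s + (2 * Real.pi * ρ - θ)) ^ (-q)) := by
  have key : ∀ t : ℝ, 0 ≤ t → t ≤ Real.pi * ρ →
      |Real.sin (t / ρ) / (Real.cosh (s / ρ) - Real.cos (t / ρ))| ^ q
        ≤ (Real.pi ^ 2 * ρ) ^ q * (s + t) ^ (-q) := by
    intro t ht ht'
    have h := abs_sin_div_cosh_sub_cos_le (a := s / ρ) (x := t / ρ) (by positivity)
      (by positivity) ((div_le_iff₀ hρ).2 ht')
    have e : Real.pi ^ 2 / (s / ρ + t / ρ) = Real.pi ^ 2 * ρ / (s + t) := by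
      field_simp
    rw [e] at h
    calc _ ≤ (Real.pi ^ 2 * ρ / (s + t)) ^ q := Real.rpow_le_rpow (abs_nonneg _) h hq
      _ = _ := by
        rw [Real.div_rpow (by positivity) (by positivity), Real.rpow_neg (by positivity),
          div_eq_mul_inv]
  have hA : 0 ≤ (Real.pi ^ 2 * ρ) ^ q := by positivity
  rw [mul_add]
  rcases le_total θ (Real.pi * ρ) with h | h
  · have : 0 ≤ (s + (2 * Real.pi * ρ - θ)) ^ (-q) := Real.rpow_nonneg (by linarith) _
    exact (key θ hθ h).trans (le_add_of_nonneg_right (by positivity))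
  · have e : (2 * Real.pi * ρ - θ) / ρ = 2 * Real.pi - θ / ρ := by field_simp
    have k := key (2 * Real.pi * ρ - θ) (by linarith) (by linarith)
    rw [e, Real.sin_two_pi_sub, Real.cos_two_pi_sub, neg_div, abs_neg] at k
    exact k.trans (le_add_of_nonneg_left (by positivity))

lemma integral_kernel_le_rpow {ρ q s : ℝ} (hρ : 0 < ρ) (hq : 1 < q) (hs : 0 < s) :
    ∫ θ in (0 : ℝ)..(2 * Real.pi * ρ),
        |Real.sin (θ / ρ) / (Real.cosh (s / ρ) - Real.cos (θ / ρ))| ^ q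
      ≤ (Real.pi ^ 2 * ρ) ^ q * (2 / (q - 1)) * s ^ (1 - q) := by
  have hL : 0 ≤ 2 * Real.pi * ρ := by positivity
  have i1 := intervalIntegrable_add_rpow (-q) hs hL
  have i2 : IntervalIntegrable (fun θ : ℝ => (s + (2 * Real.pi * ρ - θ)) ^ (-q)) volume 0
      (2 * Real.pi * ρ) := by
    simpa using (i1.comp_sub_left (2 * Real.pi * ρ)).symm
  have hI := integral_add_rpow_neg_le hs hL hq
  have hI2 : ∫ θ in (0 : ℝ)..(2 * Real.pi * ρ), (s + (2 * Real.pi * ρ - θ)) ^ (-q)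
      = ∫ θ in (0 : ℝ)..(2 * Real.pi * ρ), (s + θ) ^ (-q) := by
    rw [intervalIntegral.integral_comp_sub_left (fun x : ℝ => (s + x) ^ (-q))]
    simp
  calc _ ≤ ‖∫ θ in (0 : ℝ)..(2 * Real.pi * ρ),
        |Real.sin (θ / ρ) / (Real.cosh (s / ρ) - Real.cos (θ / ρ))| ^ q‖ := Real.le_norm_self _
    _ ≤ ∫ θ in (0 : ℝ)..(2 * Real.pi * ρ), (Real.pi ^ 2 * ρ) ^ q *
        ((s + θ) ^ (-q) + (s + (2 * Real.pi * ρ - θ)) ^ (-q)) := by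
      refine intervalIntegral.norm_integral_le_of_norm_le hL (Eventually.of_forall ?_)
        ((i1.add i2).const_mul _)
      intro θ hθ
      rw [Real.norm_of_nonneg (by positivity)]
      exact abs_kernel_rpow_le hρ (by linarith) hs hθ.1.le hθ.2
    _ = (Real.pi ^ 2 * ρ) ^ q * (2 * ∫ θ in (0 : ℝ)..(2 * Real.pi * ρ), (s + θ) ^ (-q)) := by
      rw [intervalIntegral.integral_const_mul, intervalIntegral.integral_add i1 i2, hI2,
        ← two_mul]
    _ ≤ (Real.pi ^ 2 * ρ) ^ q * (2 * (s ^ (1 - q) / (q - 1))) := by gcongr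
    _ = _ := by ring

lemma integral_kernel_le_exp {ρ q s : ℝ} (hρ : 0 < ρ) (hq : 0 ≤ q) (hs : 1 ≤ s) :
    ∫ θ in (0 : ℝ)..(2 * Real.pi * ρ),
        |Real.sin (θ / ρ) / (Real.cosh (s / ρ) - Real.cos (θ / ρ))| ^ q
      ≤ 2 * Real.pi * ρ *
        (2 / (1 - Real.exp (-(1 / ρ))) ^ 2 * Real.exp (-(s / ρ))) ^ q := by
  have hL : 0 ≤ 2 * Real.pi * ρ := by positivity
  have h := intervalIntegral.norm_integral_le_of_norm_le_const (a := 0) (b := 2 * Real.pi * ρ)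
    (f := fun θ => |Real.sin (θ / ρ) / (Real.cosh (s / ρ) - Real.cos (θ / ρ))| ^ q)
    (C := (2 / (1 - Real.exp (-(1 / ρ))) ^ 2 * Real.exp (-(s / ρ))) ^ q) (by
      intro θ _
      rw [Real.norm_of_nonneg (by positivity)]
      exact Real.rpow_le_rpow (abs_nonneg _) (abs_sin_div_cosh_sub_cos_le_exp (by positivity)
        (by gcongr) _) hq)
  rw [sub_zero, abs_of_nonneg hL, mul_comm _ (2 * Real.pi * ρ)] at h
  exact (Real.le_norm_self _).trans h

/-- `L^q` bounds in `θ` for the diffracted kernel `sin(θ/ρ)/(cosh(s/ρ) − cos(θ/ρ))`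
on the circle of circumference `2πρ`. -/
theorem diffracted_kernel_Lq_bound (ρ q : ℝ) (hρ : 1 ≤ ρ) (hq1 : 1 < q) (hq2 : q ≤ 2) :
    ∃ C : ℝ, 0 < C ∧ ∀ s : ℝ, 0 < s →
      (s < 1 →
        (∫ θ in (0 : ℝ)..(2 * Real.pi * ρ),
            |Real.sin (θ / ρ) / (Real.cosh (s / ρ) - Real.cos (θ / ρ))| ^ q) ^ (1/q)
          ≤ C * s ^ (1/q - 1)) ∧
      (1 ≤ s →
        (∫ θ in (0 : ℝ)..(2 * Real.pi * ρ),
            |Real.sin (θ / ρ) / (Real.cosh (s / ρ) - Real.cos (θ / ρ))| ^ q) ^ (1/q)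
          ≤ C * Real.exp (-(s / ρ))) := by
  have hρ0 : 0 < ρ := by linarith
  have hq0 : 0 < q := by linarith
  have hq1' : 0 < q - 1 := by linarith
  have hexp : 0 < 1 - Real.exp (-(1 / ρ)) :=
    sub_pos.2 (Real.exp_lt_one_iff.2 (neg_neg_of_pos (by positivity)))
  set D := (Real.pi ^ 2 * ρ) ^ q * (2 / (q - 1)) with hD
  set M := 2 / (1 - Real.exp (-(1 / ρ))) ^ 2 with hM
  have hD0 : 0 < D := by positivity
  have hM0 : 0 < M := by positivity
  have hI0 : ∀ s : ℝ, 0 ≤ ∫ θ in (0 : ℝ)..(2 * Real.pi * ρ),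
      |Real.sin (θ / ρ) / (Real.cosh (s / ρ) - Real.cos (θ / ρ))| ^ q := fun s =>
    intervalIntegral.integral_nonneg (by positivity) fun θ _ => by positivity
  refine ⟨D ^ (1 / q) + (2 * Real.pi * ρ) ^ (1 / q) * M, by positivity,
    fun s hs => ⟨fun _ => ?_, fun hs1 => ?_⟩⟩
  · calc _ ≤ (D * s ^ (1 - q)) ^ (1 / q) :=
        Real.rpow_le_rpow (hI0 s) (integral_kernel_le_rpow hρ0 hq1 hs) (by positivity)
      _ = D ^ (1 / q) * s ^ (1 / q - 1) := by
        rw [Real.mul_rpow hD0.le (by positivity), ← Real.rpow_mul hs.le]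
        congr 2
        field_simp
      _ ≤ _ := by
        gcongr
        exact le_add_of_nonneg_right (by positivity)
  · calc _ ≤ (2 * Real.pi * ρ * (M * Real.exp (-(s / ρ))) ^ q) ^ (1 / q) :=
        Real.rpow_le_rpow (hI0 s) (integral_kernel_le_exp hρ0 hq0.le hs1) (by positivity)
      _ = (2 * Real.pi * ρ) ^ (1 / q) * M * Real.exp (-(s / ρ)) := by
        rw [Real.mul_rpow (by positivity) (by positivity), ← Real.rpow_mul (by positivity),
          mul_one_div_cancel hq0.ne', Real.rpow_one, ← mul_assoc]
      _ ≤ _ := by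
        gcongr
        exact le_add_of_nonneg_left (by positivity)
end

section
/- For every s > 0 and every ξ ∈ ℝ, the improper integral lim_{R→∞} ∫_{−R}^{R} e^{−iξθ} · θ/(s² + θ²) dθ exists and equals −iπ sgn(ξ) e^{−s|ξ|}, where sgn(ξ) = 1 for ξ > 0, −1 for ξ < 0, and 0 for ξ = 0. -/
open MeasureTheory Set Filter

lemma integrableOn_ofReal_mul_cexp_neg_mul {c : ℂ} (hc : 0 < c.re) :
    IntegrableOn (fun x : ℝ => (x : ℂ) * Complex.exp (-(c * x))) (Ioi 0) := by
  have h : IntegrableOn (fun x : ℝ => x ^ (1 : ℝ) * Real.exp (-c.re * x ^ (1 : ℝ))) (Ioi 0) :=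
    integrableOn_rpow_mul_exp_neg_mul_rpow (by norm_num) (by norm_num) hc
  refine Integrable.mono' h (by fun_prop) ?_
  filter_upwards [ae_restrict_mem measurableSet_Ioi] with x hx
  have hx' : (0 : ℝ) < x := hx
  simp [Complex.norm_exp, abs_of_pos hx']

lemma integral_Ioi_ofReal_mul_cexp_neg_mul {c : ℂ} (hc : 0 < c.re) :
    ∫ x : ℝ in Ioi 0, (x : ℂ) * Complex.exp (-(c * x)) = 1 / c ^ 2 := by
  have hc0 : c ≠ 0 := by rintro rfl; simp at hc
  have hderiv : ∀ x ∈ Ici (0 : ℝ), HasDerivAt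
      (fun x : ℝ => -((x : ℂ) / c + 1 / c ^ 2) * Complex.exp (-(c * x)))
      ((x : ℂ) * Complex.exp (-(c * x))) x := by
    intro x _
    have h1 : HasDerivAt (fun x : ℝ => (x : ℂ)) 1 x := Complex.ofRealCLM.hasDerivAt
    refine HasDerivAt.congr_deriv
      (((h1.div_const c).add_const (1 / c ^ 2)).neg.mul ((h1.const_mul c).neg.cexp)) ?_
    simp only [Pi.neg_apply]
    field_simp
    ring
  have hexp : Tendsto (fun x : ℝ => Complex.exp (-(c * x))) atTop (nhds 0) := by
    rw [tendsto_zero_iff_norm_tendsto_zero]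
    have := Real.tendsto_exp_neg_atTop_nhds_zero.comp (tendsto_id.const_mul_atTop hc)
    refine this.congr fun x => ?_
    simp [Complex.norm_exp]
  have hmul : Tendsto (fun x : ℝ => (x : ℂ) * Complex.exp (-(c * x))) atTop (nhds 0) := by
    rw [tendsto_zero_iff_norm_tendsto_zero]
    have := tendsto_rpow_mul_exp_neg_mul_atTop_nhds_zero 1 c.re hc
    refine this.congr' ?_
    filter_upwards [eventually_gt_atTop 0] with x hx
    simp [Complex.norm_exp, abs_of_pos hx]
  have hlim : Tendsto (fun x : ℝ => -((x : ℂ) / c + 1 / c ^ 2) * Complex.exp (-(c * x)))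
      atTop (nhds 0) := by
    have := (hmul.const_mul (-(1 / c))).add (hexp.const_mul (-(1 / c ^ 2)))
    simp only [mul_zero, add_zero] at this
    refine this.congr fun x => ?_
    ring
  rw [integral_Ioi_of_hasDerivAt_of_tendsto' hderiv (integrableOn_ofReal_mul_cexp_neg_mul hc) hlim]
  simp

lemma integrable_abs_mul_exp_neg_mul_abs {s : ℝ} (hs : 0 < s) :
    Integrable (fun x : ℝ => ((|x| * Real.exp (-(s * |x|)) : ℝ) : ℂ)) := by
  have h : IntegrableOn (fun x : ℝ => ((|x| * Real.exp (-(s * |x|)) : ℝ) : ℂ)) (Ioi 0) := by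
    refine (integrableOn_ofReal_mul_cexp_neg_mul (c := s) (by simpa)).congr_fun ?_ measurableSet_Ioi
    intro x hx
    have hx' : (0 : ℝ) < x := hx
    simp [abs_of_pos hx']
  rw [← integrableOn_univ, ← Iic_union_Ioi (a := (0 : ℝ)), integrableOn_union]
  refine ⟨?_, h⟩
  have h' := IntegrableOn.comp_neg_Iic (c := (0 : ℝ))
    (f := fun x : ℝ => ((|x| * Real.exp (-(s * |x|)) : ℝ) : ℂ))
    (by rw [neg_zero]; exact (integrableOn_Ici_iff_integrableOn_Ioi (by simp)).2 h)
  simpa only [abs_neg] using h'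

lemma fourier_abs_mul_exp_neg_mul_abs {s : ℝ} (hs : 0 < s) (ω : ℝ) :
    ∫ x : ℝ, Complex.exp (-(Complex.I * ω * x)) * ((|x| * Real.exp (-(s * |x|)) : ℝ) : ℂ) =
      2 * (((s : ℂ) ^ 2 - (ω : ℂ) ^ 2) / ((s : ℂ) ^ 2 + (ω : ℂ) ^ 2) ^ 2) := by
  have hint : Integrable (fun x : ℝ =>
      Complex.exp (-(Complex.I * ω * x)) * ((|x| * Real.exp (-(s * |x|)) : ℝ) : ℂ)) := by
    refine (integrable_abs_mul_exp_neg_mul_abs hs).bdd_mul (c := 1) (by fun_prop) ?_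
    refine Eventually.of_forall fun x => ?_
    simp [Complex.norm_exp]
  have hneg := integral_comp_neg_Ioi (0 : ℝ) (fun x : ℝ =>
    Complex.exp (-(Complex.I * ω * x)) * ((|x| * Real.exp (-(s * |x|)) : ℝ) : ℂ))
  rw [neg_zero] at hneg
  rw [← intervalIntegral.integral_Iic_add_Ioi (b := (0 : ℝ)) hint.integrableOn hint.integrableOn,
    ← hneg]
  have e1 := integral_Ioi_ofReal_mul_cexp_neg_mul (c := s - Complex.I * ω) (by simpa)
  have e2 := integral_Ioi_ofReal_mul_cexp_neg_mul (c := s + Complex.I * ω) (by simpa)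
  have h1 : (s : ℂ) - Complex.I * ω ≠ 0 := by
    intro h; have := congrArg Complex.re h; simp at this; exact hs.ne' this
  have h2 : (s : ℂ) + Complex.I * ω ≠ 0 := by
    intro h; have := congrArg Complex.re h; simp at this; exact hs.ne' this
  have h3 : (s : ℂ) ^ 2 + (ω : ℂ) ^ 2 = (s - Complex.I * ω) * (s + Complex.I * ω) := by
    linear_combination ((ω : ℂ) ^ 2) * Complex.I_sq
  calc _ = 1 / (s - Complex.I * ω : ℂ) ^ 2 + 1 / (s + Complex.I * ω : ℂ) ^ 2 := by
        rw [← e1, ← e2]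
        congr 1 <;> refine setIntegral_congr_fun measurableSet_Ioi fun x hx => ?_
        all_goals
          have hx' : (0 : ℝ) < x := hx
          simp only [abs_neg, abs_of_pos hx']
          push_cast
          rw [mul_left_comm, ← Complex.exp_add]
          congr 2
          ring
    _ = _ := by
        rw [h3]
        field_simp
        linear_combination (2 * (ω : ℂ) ^ 2) * Complex.I_sq

lemma integrable_sq_sub_sq_div_sq_add_sq_sq {s : ℝ} (hs : 0 < s) :
    Integrable (fun ω : ℝ => ((s : ℂ) ^ 2 - (ω : ℂ) ^ 2) / ((s : ℂ) ^ 2 + (ω : ℂ) ^ 2) ^ 2) := by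
  have h : Integrable (fun ω : ℝ => (s ^ 2)⁻¹ * (1 + (ω / s) ^ 2)⁻¹) :=
    (integrable_inv_one_add_sq.comp_div hs.ne').const_mul _
  refine h.mono' (Measurable.aestronglyMeasurable (by fun_prop)) (Eventually.of_forall fun ω => ?_)
  have e : ((s : ℂ) ^ 2 - (ω : ℂ) ^ 2) / ((s : ℂ) ^ 2 + (ω : ℂ) ^ 2) ^ 2 =
    (((s ^ 2 - ω ^ 2) / (s ^ 2 + ω ^ 2) ^ 2 : ℝ) : ℂ) := by push_cast; rfl
  have hp : 0 < s ^ 2 + ω ^ 2 := by positivity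
  have e2 : (s ^ 2)⁻¹ * (1 + (ω / s) ^ 2)⁻¹ = (s ^ 2 + ω ^ 2) / (s ^ 2 + ω ^ 2) ^ 2 := by
    field_simp
  rw [e, Complex.norm_real, Real.norm_eq_abs, abs_div, abs_of_pos (pow_pos hp 2), e2]
  gcongr
  rw [abs_le]
  constructor <;> nlinarith [sq_nonneg s, sq_nonneg ω]

open FourierTransform in
lemma fourier_sq_sub_sq_div_sq_add_sq_sq {s : ℝ} (hs : 0 < s) (ξ : ℝ) :
    ∫ θ : ℝ, Complex.exp (-Complex.I * ξ * θ) *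
      (((s : ℂ) ^ 2 - (θ : ℂ) ^ 2) / ((s : ℂ) ^ 2 + (θ : ℂ) ^ 2) ^ 2) =
      Real.pi * ((|ξ| * Real.exp (-(s * |ξ|)) : ℝ) : ℂ) := by
  set h : ℝ → ℂ := fun x => ((|x| * Real.exp (-(s * |x|)) : ℝ) : ℂ) with hh
  set k : ℝ → ℂ := fun θ => ((s : ℂ) ^ 2 - (θ : ℂ) ^ 2) / ((s : ℂ) ^ 2 + (θ : ℂ) ^ 2) ^ 2 with hk
  have hπ := Real.pi_pos
  have hF : 𝓕 h = fun w => 2 * k (2 * Real.pi * w) := by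
    ext w
    rw [Real.fourier_real_eq_integral_exp_smul, hk, ← fourier_abs_mul_exp_neg_mul_abs hs]
    congr 1
    ext x
    rw [smul_eq_mul]
    congr 2
    push_cast
    ring
  have hFi : Integrable (𝓕 h) := by
    rw [hF]
    exact ((integrable_sq_sub_sq_div_sq_add_sq_sq hs).comp_mul_left' (by positivity)).const_mul 2
  have hcont : Continuous h := by fun_prop
  have inv := congrFun (hcont.fourierInv_fourier_eq (integrable_abs_mul_exp_neg_mul_abs hs) hFi) (-ξ)
  rw [Real.fourierInv_eq_fourier_neg, Real.fourier_real_eq_integral_exp_smul, hF] at inv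
  have hsub := Measure.integral_comp_mul_left
    (fun θ : ℝ => Complex.exp (-Complex.I * ξ * θ) * k θ) (2 * Real.pi)
  have hI : h (-ξ) = 2 * ∫ x : ℝ, Complex.exp (-Complex.I * ξ * ((2 * Real.pi * x : ℝ) : ℂ)) *
      k (2 * Real.pi * x) := by
    rw [← inv, ← integral_const_mul]
    congr 1
    ext x
    rw [smul_eq_mul, mul_left_comm]
    congr 3
    push_cast
    ring
  rw [hsub, abs_of_pos (by positivity), Complex.real_smul] at hI
  have hn : h (-ξ) = h ξ := by simp [hh]
  have hπ' : (Real.pi : ℂ) ≠ 0 := by exact_mod_cast hπ.ne'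
  change ∫ θ : ℝ, Complex.exp (-Complex.I * ξ * θ) * k θ = Real.pi * h ξ
  rw [← hn, hI]
  push_cast
  field_simp

lemma hasDerivAt_div_sq_add_sq {s : ℝ} (hs : 0 < s) (θ : ℝ) :
    HasDerivAt (fun θ : ℝ => (θ : ℂ) / ((s : ℂ) ^ 2 + (θ : ℂ) ^ 2))
      (((s : ℂ) ^ 2 - (θ : ℂ) ^ 2) / ((s : ℂ) ^ 2 + (θ : ℂ) ^ 2) ^ 2) θ := by
  have h1 : HasDerivAt (fun x : ℝ => (x : ℂ)) 1 θ := Complex.ofRealCLM.hasDerivAt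
  have hne : (s : ℂ) ^ 2 + (θ : ℂ) ^ 2 ≠ 0 := by
    have : s ^ 2 + θ ^ 2 ≠ 0 := by positivity
    exact_mod_cast this
  refine (h1.div ((h1.pow 2).const_add ((s : ℂ) ^ 2)) hne).congr_deriv ?_
  simp
  ring

lemma tendsto_div_sq_add_sq_atTop (s : ℝ) :
    Tendsto (fun θ : ℝ => (θ : ℂ) / ((s : ℂ) ^ 2 + (θ : ℂ) ^ 2)) atTop (nhds 0) := by
  refine squeeze_zero_norm' ?_ tendsto_inv_atTop_zero
  filter_upwards [eventually_gt_atTop 0] with θ hθ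
  have e : (θ : ℂ) / ((s : ℂ) ^ 2 + (θ : ℂ) ^ 2) = ((θ / (s ^ 2 + θ ^ 2) : ℝ) : ℂ) := by
    push_cast; rfl
  rw [e, Complex.norm_real, Real.norm_of_nonneg (by positivity), inv_eq_one_div,
    div_le_div_iff₀ (by positivity) hθ]
  nlinarith [sq_nonneg s]

/-- The Fourier transform of the conjugate Poisson kernel `θ ↦ θ/(s² + θ²)`, computed as an
improper integral over symmetric intervals, is `−iπ sgn(ξ) e^{−s|ξ|}`. -/
theorem conjugate_poisson_fourier_transform (s ξ : ℝ) (hs : 0 < s) :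
    Tendsto
      (fun R : ℝ => ∫ θ in (-R)..R,
        Complex.exp (-(Complex.I) * (ξ : ℂ) * (θ : ℂ)) * ((θ : ℂ) / ((s : ℂ) ^ 2 + (θ : ℂ) ^ 2)))
      atTop
      (nhds (-(Complex.I) * (Real.pi : ℂ) * ((Real.sign ξ : ℝ) : ℂ)
        * ((Real.exp (-(s * |ξ|)) : ℝ) : ℂ))) := by
  rcases eq_or_ne ξ 0 with rfl | hξ
  · have hodd (R : ℝ) : ∫ θ in (-R)..R, Complex.exp (-(Complex.I) * ((0 : ℝ) : ℂ) * (θ : ℂ)) *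
        ((θ : ℂ) / ((s : ℂ) ^ 2 + (θ : ℂ) ^ 2)) = 0 := by
      have := intervalIntegral.integral_comp_neg (a := -R) (b := R)
        (fun θ : ℝ => (θ : ℂ) / ((s : ℂ) ^ 2 + (θ : ℂ) ^ 2))
      simp only [Complex.ofReal_neg, neg_sq, neg_div, intervalIntegral.integral_neg, neg_neg] at this
      simpa using self_eq_neg.mp this.symm
    simp only [hodd]
    simp
  have hξ' : (ξ : ℂ) ≠ 0 := by exact_mod_cast hξ
  set a : ℂ := -Complex.I * ξ with ha
  have ha0 : a ≠ 0 := by simp [ha, hξ]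
  set q : ℝ → ℂ := fun θ => (θ : ℂ) / ((s : ℂ) ^ 2 + (θ : ℂ) ^ 2) with hq
  set k : ℝ → ℂ := fun θ => ((s : ℂ) ^ 2 - (θ : ℂ) ^ 2) / ((s : ℂ) ^ 2 + (θ : ℂ) ^ 2) ^ 2 with hk
  have hki : Integrable k := integrable_sq_sub_sq_div_sq_add_sq_sq hs
  have hexp (θ : ℝ) : HasDerivAt (fun θ : ℝ => Complex.exp (a * θ) / a) (Complex.exp (a * θ)) θ := by
    have h1 : HasDerivAt (fun x : ℝ => (x : ℂ)) 1 θ := Complex.ofRealCLM.hasDerivAt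
    refine ((h1.const_mul a).cexp.div_const a).congr_deriv ?_
    field_simp
  have hnorm (θ : ℝ) : ‖Complex.exp (a * θ)‖ = 1 := by simp [ha, Complex.norm_exp]
  have hparts (R : ℝ) : ∫ θ in (-R)..R, Complex.exp (a * θ) * q θ =
      (Complex.exp (a * R) + Complex.exp (a * (-R : ℝ))) / a * q R -
        (∫ θ in (-R)..R, Complex.exp (a * θ) * k θ) / a := by
    have := intervalIntegral.integral_deriv_mul_eq_sub_of_hasDerivAt (a := -R) (b := R)
      (fun x _ => (hexp x).continuousAt.continuousWithinAt)
      (fun x _ => (hasDerivAt_div_sq_add_sq hs x).continuousAt.continuousWithinAt)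
      (fun x _ => hexp x) (fun x _ => hasDerivAt_div_sq_add_sq hs x)
      (Continuous.intervalIntegrable (by fun_prop) _ _) hki.intervalIntegrable
    rw [intervalIntegral.integral_add] at this
    · have e : ∫ θ in (-R)..R, Complex.exp (a * θ) / a * k θ =
          (∫ θ in (-R)..R, Complex.exp (a * θ) * k θ) / a := by
        rw [← intervalIntegral.integral_div]
        congr 1
        ext θ
        ring
      rw [e] at this
      rw [eq_sub_iff_add_eq]
      refine this.trans ?_
      simp only [hq]
      push_cast
      ring
    · refine Continuous.intervalIntegrable ?_ _ _
      refine Continuous.mul (by fun_prop) ?_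
      exact continuous_iff_continuousAt.2 fun x => (hasDerivAt_div_sq_add_sq hs x).continuousAt
    · exact hki.intervalIntegrable.continuousOn_mul (by fun_prop)
  refine Tendsto.congr (fun R => (hparts R).symm) ?_
  have hbd : Tendsto (fun R : ℝ => (Complex.exp (a * R) + Complex.exp (a * (-R : ℝ))) / a * q R)
      atTop (nhds 0) := by
    have hq0 := (tendsto_div_sq_add_sq_atTop s).norm.const_mul (2 / ‖a‖)
    rw [norm_zero, mul_zero] at hq0
    refine squeeze_zero_norm (fun R => ?_) hq0
    rw [norm_mul, norm_div]
    gcongr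
    refine (norm_add_le _ _).trans ?_
    rw [hnorm, hnorm]
    norm_num
  have hki' : Integrable (fun θ : ℝ => Complex.exp (a * θ) * k θ) :=
    hki.bdd_mul (c := 1) (by fun_prop) (Eventually.of_forall fun θ => (hnorm θ).le)
  have hlim := hbd.sub ((intervalIntegral_tendsto_integral hki' tendsto_neg_atTop_atBot
    tendsto_id).div_const a)
  rw [fourier_sq_sub_sq_div_sq_add_sq_sq hs ξ] at hlim
  have hsign : ((|ξ| : ℝ) : ℂ) = (Real.sign ξ : ℝ) * (ξ : ℂ) := by
    rcases hξ.lt_or_gt with h | h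
    · simp [Real.sign_of_neg h, abs_of_neg h]
    · simp [Real.sign_of_pos h, abs_of_pos h]
  have hval : -(Complex.I) * (Real.pi : ℂ) * ((Real.sign ξ : ℝ) : ℂ) *
      ((Real.exp (-(s * |ξ|)) : ℝ) : ℂ) =
      0 - Real.pi * ((|ξ| * Real.exp (-(s * |ξ|)) : ℝ) : ℂ) / a := by
    rw [Complex.ofReal_mul, hsign, ha]
    have hI := Complex.I_ne_zero
    field_simp
    simp
  rw [hval]
  exact hlim
end

section
/- There is an absolute constant C such that for all μ > 0 and all x > 0, |∫₀^∞ e^{iμs²} e^{−sx} ds| ≤ C · min(μ^{−1/2}, x^{−1}). -/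
open MeasureTheory Set Filter

lemma norm_fresnel_integrand (μ x s : ℝ) :
    ‖Complex.exp (Complex.I * (μ : ℂ) * (s : ℂ) ^ 2) * Complex.exp (-((s : ℂ) * (x : ℂ)))‖
      = Real.exp (-x * s) := by
  rw [← Complex.exp_add, Complex.norm_exp]
  congr 1
  simp [pow_two, mul_comm]

lemma integrableOn_fresnel_integrand (μ a : ℝ) {x : ℝ} (hx : 0 < x) :
    IntegrableOn (fun s : ℝ ↦ Complex.exp (Complex.I * (μ : ℂ) * (s : ℂ) ^ 2) *
      Complex.exp (-((s : ℂ) * (x : ℂ)))) (Ioi a) := by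
  refine (exp_neg_integrableOn_Ioi a hx).mono' ?_ ?_
  · exact (by fun_prop : Continuous _).aestronglyMeasurable
  · exact ae_of_all _ fun s ↦ (norm_fresnel_integrand μ x s).le

lemma norm_fresnel_integral_le_inv (μ : ℝ) {x : ℝ} (hx : 0 < x) :
    ‖∫ s in Ioi (0 : ℝ), Complex.exp (Complex.I * (μ : ℂ) * (s : ℂ) ^ 2) *
      Complex.exp (-((s : ℂ) * (x : ℂ)))‖ ≤ x⁻¹ := by
  refine (norm_integral_le_integral_norm _).trans ?_
  simp_rw [norm_fresnel_integrand]
  rw [integral_exp_mul_Ioi (by linarith)]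
  simp

lemma two_mul_mul_le_norm_fresnel_phase_deriv (μ x s : ℝ) :
    2 * μ * s ≤ ‖2 * Complex.I * (μ : ℂ) * (s : ℂ) - (x : ℂ)‖ := by
  refine le_trans ?_ (Complex.abs_im_le_norm _)
  refine le_trans ?_ (le_abs_self _)
  simp

/-- The tail estimate obtained from one integration by parts. -/
lemma norm_fresnel_tail_le {μ x a : ℝ} (hμ : 0 < μ) (hx : 0 < x) (ha : 0 < a) :
    ‖∫ s in Ioi a, Complex.exp (Complex.I * (μ : ℂ) * (s : ℂ) ^ 2) *
      Complex.exp (-((s : ℂ) * (x : ℂ)))‖ ≤ (μ * a)⁻¹ := by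
  set f : ℝ → ℂ := fun s ↦ Complex.exp (Complex.I * (μ : ℂ) * (s : ℂ) ^ 2) *
      Complex.exp (-((s : ℂ) * (x : ℂ))) with hf
  set p : ℝ → ℂ := fun s ↦ 2 * Complex.I * (μ : ℂ) * (s : ℂ) - (x : ℂ) with hp
  have hple (s : ℝ) : 2 * μ * s ≤ ‖p s‖ := two_mul_mul_le_norm_fresnel_phase_deriv μ x s
  have hp0 (s : ℝ) (hs : 0 < s) : p s ≠ 0 :=
    norm_pos_iff.1 (lt_of_lt_of_le (by positivity) (hple s))
  have hfle (s : ℝ) (hs : 0 < s) : ‖f s‖ ≤ 1 := by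
    rw [hf, norm_fresnel_integrand, Real.exp_le_one_iff]
    nlinarith
  have hfi : IntegrableOn f (Ioi a) := integrableOn_fresnel_integrand μ a hx
  have hdp (s : ℝ) : HasDerivAt p (2 * Complex.I * μ) s := by
    simpa [hp] using (Complex.ofRealCLM.hasDerivAt (x := s)).const_mul (2 * Complex.I * (μ : ℂ))
  have hdf (s : ℝ) : HasDerivAt f (f s * p s) s := by
    have h := Complex.ofRealCLM.hasDerivAt (x := s)
    have h1 := ((h.pow 2).const_mul (Complex.I * (μ : ℂ))).cexp.mul (h.mul_const (x : ℂ)).neg.cexp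
    refine h1.congr_deriv ?_
    simp [hf, hp]
    ring
  have hGle (s : ℝ) (hs : 0 < s) : ‖f s / p s‖ ≤ (2 * μ * s)⁻¹ := by
    rw [norm_div, ← one_div]
    exact div_le_div₀ zero_le_one (hfle s hs) (by positivity) (hple s)
  have hrle (s : ℝ) (hs : 0 < s) :
      ‖f s * (2 * Complex.I * μ) / p s ^ 2‖ ≤ (2 * μ)⁻¹ * s ^ (-2 : ℝ) := by
    have h2 : ‖f s * (2 * Complex.I * μ)‖ ≤ 2 * μ := by
      rw [norm_mul]
      have : ‖2 * Complex.I * (μ : ℂ)‖ = 2 * μ := by simp [abs_of_pos hμ]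
      rw [this]
      exact mul_le_of_le_one_left (by positivity) (hfle s hs)
    rw [norm_div, norm_pow, Real.rpow_neg hs.le, Real.rpow_two]
    calc _ ≤ 2 * μ / (2 * μ * s) ^ 2 :=
          div_le_div₀ (by positivity) h2 (by positivity)
            (pow_le_pow_left₀ (by positivity) (hple s) 2)
      _ = _ := by field_simp
  have hsi : IntegrableOn (fun s : ℝ ↦ (2 * μ)⁻¹ * s ^ (-2 : ℝ)) (Ioi a) :=
    (integrableOn_Ioi_rpow_of_lt (by norm_num) ha).const_mul _
  have hae : ∀ᵐ s ∂volume.restrict (Ioi a),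
      ‖f s * (2 * Complex.I * μ) / p s ^ 2‖ ≤ (2 * μ)⁻¹ * s ^ (-2 : ℝ) :=
    (ae_restrict_mem measurableSet_Ioi).mono fun s hs ↦ hrle s (ha.trans hs)
  have hri : IntegrableOn (fun s ↦ f s * (2 * Complex.I * μ) / p s ^ 2) (Ioi a) := by
    refine hsi.mono' ?_ hae
    have : Measurable f := by fun_prop
    have : Measurable p := by fun_prop
    exact Measurable.aestronglyMeasurable (by fun_prop)
  have hdG (s : ℝ) (hs : s ∈ Ici a) :
      HasDerivAt (fun t ↦ f t / p t) (f s - f s * (2 * Complex.I * μ) / p s ^ 2) s := by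
    have h0 := hp0 s (ha.trans_le hs)
    refine ((hdf s).div (hdp s) h0).congr_deriv ?_
    field_simp
  have hG : Tendsto (fun s ↦ f s / p s) atTop (nhds 0) := by
    refine squeeze_zero_norm' ((eventually_gt_atTop 0).mono hGle) ?_
    exact tendsto_inv_atTop_zero.comp (tendsto_id.const_mul_atTop (by positivity))
  have hparts := integral_Ioi_of_hasDerivAt_of_tendsto' hdG (hfi.sub hri) hG
  rw [integral_sub hfi hri, sub_eq_iff_eq_add] at hparts
  have hrint : ‖∫ s in Ioi a, f s * (2 * Complex.I * μ) / p s ^ 2‖ ≤ (2 * μ * a)⁻¹ := by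
    refine (norm_integral_le_of_norm_le hsi hae).trans_eq ?_
    rw [integral_const_mul, integral_Ioi_rpow_of_lt (by norm_num) ha]
    norm_num [Real.rpow_neg_one]
    ring
  rw [hparts, zero_sub]
  calc _ ≤ ‖-(f a / p a)‖ + _ := norm_add_le _ _
    _ ≤ (2 * μ * a)⁻¹ + (2 * μ * a)⁻¹ := by
      rw [norm_neg]
      exact add_le_add (hGle a ha) hrint
    _ = (μ * a)⁻¹ := by field_simp; norm_num

lemma norm_fresnel_integral_le_rpow {μ x : ℝ} (hμ : 0 < μ) (hx : 0 < x) :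
    ‖∫ s in Ioi (0 : ℝ), Complex.exp (Complex.I * (μ : ℂ) * (s : ℂ) ^ 2) *
      Complex.exp (-((s : ℂ) * (x : ℂ)))‖ ≤ 2 * μ ^ (-(1/2) : ℝ) := by
  set a : ℝ := μ ^ (-(1/2) : ℝ) with ha_def
  have ha : 0 < a := Real.rpow_pos_of_pos hμ _
  have hμa : (μ * a)⁻¹ = a := by
    have : a * a = μ⁻¹ := by
      rw [ha_def, ← Real.rpow_add hμ, ← Real.rpow_neg_one]
      norm_num
    refine inv_eq_of_mul_eq_one_right ?_
    rw [mul_assoc, this, mul_inv_cancel₀ hμ.ne']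
  have hi := integrableOn_fresnel_integrand μ 0 hx
  rw [← Ioc_union_Ioi_eq_Ioi ha.le, setIntegral_union (Ioc_disjoint_Ioi le_rfl) measurableSet_Ioi
    (hi.mono_set Ioc_subset_Ioi_self) (hi.mono_set (Ioi_subset_Ioi ha.le)), two_mul]
  refine (norm_add_le _ _).trans (add_le_add ?_ ?_)
  · refine (norm_setIntegral_le_of_norm_le_const (C := 1) measure_Ioc_lt_top fun s hs ↦ ?_).trans ?_
    · rw [norm_fresnel_integrand, Real.exp_le_one_iff]
      nlinarith [hs.1]
    · simp [ha.le]
  · exact (norm_fresnel_tail_le hμ hx ha).trans_eq hμa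

/-- Uniform bound `|∫₀^∞ e^{iμs²} e^{−sx} ds| ≤ C min(μ^{−1/2}, x^{−1})` for `μ, x > 0`. -/
theorem fresnel_exponential_bound :
    ∃ C : ℝ, ∀ μ x : ℝ, 0 < μ → 0 < x →
      ‖∫ s in Set.Ioi (0 : ℝ),
          Complex.exp (Complex.I * (μ : ℂ) * (s : ℂ) ^ 2) * Complex.exp (-((s : ℂ) * (x : ℂ)))‖
        ≤ C * min (μ ^ (-(1/2) : ℝ)) x⁻¹ := by
  refine ⟨2, fun μ x hμ hx ↦ ?_⟩
  rw [mul_min_of_nonneg _ _ zero_le_two]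
  refine le_min (norm_fresnel_integral_le_rpow hμ hx) ?_
  exact (norm_fresnel_integral_le_inv μ hx).trans (by linarith [inv_pos.2 hx])
end

section
/- For all μ > 0 and x ≥ 0, the series Σ_{k=0}^∞ ((−x)^k / k!) · (1/2) Γ((k+1)/2) e^{iπ(k+1)/4} μ^{−(k+1)/2} converges absolutely, and its sum equals ∫₀^∞ e^{iμs²} e^{−sx} ds (for x > 0; for x = 0 the integral is understood as the improper limit lim_{R→∞} ∫₀^R e^{iμs²} ds). -/
open MeasureTheory Set Filter

/-- The `k`-th term of the series obtained by expanding `e^{−sx}` and integrating term by term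
against `e^{iμs²}`:  `((−x)^k/k!) ⋅ (1/2)Γ((k+1)/2) e^{iπ(k+1)/4} μ^{−(k+1)/2}`. -/
noncomputable def fresnelSeriesTerm (μ x : ℝ) (k : ℕ) : ℂ :=
  (((-x) ^ k / (Nat.factorial k) : ℝ) : ℂ) * ((1/2 : ℂ)
    * ((Real.Gamma (((k : ℝ) + 1) / 2) : ℝ) : ℂ)
    * Complex.exp (Complex.I * (Real.pi : ℂ) * (((k : ℝ) + 1 : ℝ) : ℂ) / 4)
    * ((μ ^ (-(((k : ℝ) + 1) / 2)) : ℝ) : ℂ))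

lemma integrableOn_pow_mul_exp_neg_mul_sq {b : ℝ} (hb : 0 < b) (k : ℕ) :
    IntegrableOn (fun s : ℝ => s ^ k * Real.exp (-b * s ^ 2)) (Ioi 0) := by
  simpa using integrableOn_rpow_mul_exp_neg_mul_sq hb (s := k)
    (by have := k.cast_nonneg (α := ℝ); linarith)

lemma integral_pow_mul_exp_neg_mul_sq {b : ℝ} (hb : 0 < b) (k : ℕ) :
    ∫ s in Ioi (0 : ℝ), s ^ k * Real.exp (-b * s ^ 2) =
      1 / 2 * Real.Gamma (((k : ℝ) + 1) / 2) * b ^ (-(((k : ℝ) + 1) / 2)) := by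
  have h := integral_rpow_mul_exp_neg_mul_rpow (p := 2) (q := k) (b := b) two_pos
    (by have := k.cast_nonneg (α := ℝ); linarith) hb
  simp only [Real.rpow_natCast, Real.rpow_two] at h
  rw [h, neg_div]
  ring

lemma norm_pow_mul_cexp_neg_mul_sq (b : ℂ) (k : ℕ) {s : ℝ} (hs : 0 ≤ s) :
    ‖(s : ℂ) ^ k * Complex.exp (-b * (s : ℂ) ^ 2)‖ = s ^ k * Real.exp (-b.re * s ^ 2) := by
  rw [norm_mul, norm_pow, norm_cexp_neg_mul_sq, Complex.norm_real, Real.norm_of_nonneg hs]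

lemma integrableOn_pow_mul_cexp_neg_mul_sq {b : ℂ} (hb : 0 < b.re) (k : ℕ) :
    IntegrableOn (fun s : ℝ => (s : ℂ) ^ k * Complex.exp (-b * (s : ℂ) ^ 2)) (Ioi 0) := by
  refine Integrable.mono' (integrableOn_pow_mul_exp_neg_mul_sq hb k)
    (by fun_prop) ?_
  filter_upwards [ae_restrict_mem measurableSet_Ioi] with s hs
  exact (norm_pow_mul_cexp_neg_mul_sq b k (le_of_lt hs)).le

lemma integral_pow_add_two_mul_cexp_neg_mul_sq {b : ℂ} (hb : 0 < b.re) (k : ℕ) :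
    ∫ s in Ioi (0 : ℝ), (s : ℂ) ^ (k + 2) * Complex.exp (-b * (s : ℂ) ^ 2) =
      (k + 1) / (2 * b) * ∫ s in Ioi (0 : ℝ), (s : ℂ) ^ k * Complex.exp (-b * (s : ℂ) ^ 2) := by
  have hb0 : b ≠ 0 := by rintro rfl; simp at hb
  have hI := integrableOn_pow_mul_cexp_neg_mul_sq hb
  have hd : ∀ s : ℝ, HasDerivAt (fun s : ℝ => (s : ℂ) ^ (k + 1) * Complex.exp (-b * (s : ℂ) ^ 2))
      ((k + 1) * ((s : ℂ) ^ k * Complex.exp (-b * (s : ℂ) ^ 2))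
        - 2 * b * ((s : ℂ) ^ (k + 2) * Complex.exp (-b * (s : ℂ) ^ 2))) s := by
    intro s
    have h := ((hasDerivAt_pow (k + 1) (s : ℂ)).mul
      (((hasDerivAt_pow 2 (s : ℂ)).const_mul (-b)).cexp)).comp_ofReal
    convert! h using 1
    push_cast
    ring
  have hint := ((hI k).const_mul ((k : ℂ) + 1)).sub ((hI (k + 2)).const_mul (2 * b))
  have h := integral_Ioi_of_hasDerivAt_of_tendsto' (a := 0) (fun s _ => hd s) hint
    (tendsto_zero_of_hasDerivAt_of_integrableOn_Ioi (a := 0) (fun s _ => hd s) hint (hI (k + 1)))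
  rw [integral_sub ((hI k).const_mul _) ((hI (k + 2)).const_mul _), integral_const_mul,
    integral_const_mul] at h
  simp only [Complex.ofReal_zero, zero_pow (Nat.succ_ne_zero k), zero_mul, sub_zero] at h
  rw [div_mul_eq_mul_div, eq_div_iff (mul_ne_zero two_ne_zero hb0)]
  linear_combination -h

lemma integral_pow_mul_cexp_neg_mul_sq {b : ℂ} (hb : 0 < b.re) (k : ℕ) :
    ∫ s in Ioi (0 : ℝ), (s : ℂ) ^ k * Complex.exp (-b * (s : ℂ) ^ 2) =
      1 / 2 * (Real.Gamma (((k : ℝ) + 1) / 2) : ℂ) * b ^ ((-(((k : ℝ) + 1) / 2) : ℝ) : ℂ) := by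
  have hb0 : b ≠ 0 := by rintro rfl; simp at hb
  induction k using Nat.twoStepInduction with
  | zero =>
    have hpi : ((Real.pi : ℂ) / b) ^ (1 / 2 : ℂ) = Real.pi ^ (1 / 2 : ℂ) * b ^ (-(1 / 2) : ℂ) := by
      have hπ : (Real.pi : ℂ) ≠ 0 := Complex.ofReal_ne_zero.mpr Real.pi_ne_zero
      have harg : b.arg ≠ Real.pi := fun h => by
        have := (Complex.arg_eq_pi_iff.mp h).1
        linarith
      rw [Complex.cpow_def_of_ne_zero (div_ne_zero hπ hb0), Complex.cpow_def_of_ne_zero hπ,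
        Complex.cpow_def_of_ne_zero hb0, div_eq_mul_inv,
        Complex.log_ofReal_mul Real.pi_pos (inv_ne_zero hb0), Complex.log_inv _ harg,
        Complex.ofReal_log Real.pi_pos.le, ← Complex.exp_add]
      ring_nf
    have hG : ((Real.Gamma (1 / 2) : ℝ) : ℂ) = Real.pi ^ (1 / 2 : ℂ) := by
      rw [Real.Gamma_one_half_eq, Real.sqrt_eq_rpow, Complex.ofReal_cpow Real.pi_pos.le]
      norm_num
    simp only [pow_zero, one_mul, integral_gaussian_complex_Ioi hb, hpi, Nat.cast_zero, zero_add,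
      hG]
    push_cast
    ring
  | one =>
    simp only [pow_one, integral_mul_cexp_neg_mul_sq hb, Nat.cast_one]
    norm_num [Complex.cpow_neg_one, mul_comm]
  | more k ih _ =>
    rw [integral_pow_add_two_mul_cexp_neg_mul_sq hb, ih]
    have hk : ((k : ℝ) + 1) / 2 ≠ 0 := by positivity
    have h1 : (((k + 2 : ℕ) : ℝ) + 1) / 2 = ((k : ℝ) + 1) / 2 + 1 := by push_cast; ring
    rw [h1, Real.Gamma_add_one hk, neg_add]
    push_cast
    rw [Complex.cpow_add _ _ hb0, Complex.cpow_neg_one]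
    field_simp

lemma norm_integral_Ioi_cexp_neg_mul_sq_le {b : ℂ} (hb : 0 < b.re) {R : ℝ} (hR : 0 < R) :
    ‖∫ s in Ioi R, Complex.exp (-b * (s : ℂ) ^ 2)‖ ≤ 1 / (‖b‖ * R) := by
  have hb0 : b ≠ 0 := by rintro rfl; simp at hb
  have hbn : 0 < ‖b‖ := norm_pos_iff.mpr hb0
  have hle : ∀ s : ℝ, ‖Complex.exp (-b * (s : ℂ) ^ 2)‖ ≤ 1 := fun s => by
    rw [norm_cexp_neg_mul_sq, Real.exp_le_one_iff]
    nlinarith [mul_nonneg hb.le (sq_nonneg s)]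
  have hsq : IntegrableOn (fun s : ℝ => 1 / (2 * ‖b‖) * s ^ (-2 : ℝ)) (Ioi R) :=
    (integrableOn_Ioi_rpow_of_lt (by norm_num) hR).const_mul _
  have hbound : ∀ s ∈ Ioi R, ‖Complex.exp (-b * (s : ℂ) ^ 2) / (2 * b * (s : ℂ) ^ 2)‖
      ≤ 1 / (2 * ‖b‖) * s ^ (-2 : ℝ) := by
    intro s hs
    have hs0 : 0 < s := hR.trans hs
    rw [norm_div, norm_mul, norm_mul, norm_pow, Complex.norm_real, Real.norm_of_nonneg hs0.le,
      Real.rpow_neg hs0.le, Real.rpow_two, Complex.norm_ofNat, ← one_div, one_div_mul_one_div,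
      div_eq_mul_one_div]
    exact mul_le_of_le_one_left (by positivity) (hle s)
  have hI1 : IntegrableOn (fun s : ℝ => Complex.exp (-b * (s : ℂ) ^ 2)) (Ioi R) :=
    (integrable_cexp_neg_mul_sq hb).integrableOn
  have hI2 : IntegrableOn
      (fun s : ℝ => Complex.exp (-b * (s : ℂ) ^ 2) / (2 * b * (s : ℂ) ^ 2)) (Ioi R) :=
    Integrable.mono' hsq (Measurable.aestronglyMeasurable (by fun_prop))
      ((ae_restrict_mem measurableSet_Ioi).mono hbound)
  have hd : ∀ s ∈ Ici R, HasDerivAt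
      (fun s : ℝ => -Complex.exp (-b * (s : ℂ) ^ 2) / (2 * b * (s : ℂ)))
      (Complex.exp (-b * (s : ℂ) ^ 2) + Complex.exp (-b * (s : ℂ) ^ 2) / (2 * b * (s : ℂ) ^ 2))
      s := by
    intro s hs
    have hs0 : (s : ℂ) ≠ 0 := Complex.ofReal_ne_zero.mpr (hR.trans_le hs).ne'
    have h := ((((hasDerivAt_pow 2 (s : ℂ)).const_mul (-b)).cexp.neg).div
      ((hasDerivAt_id (s : ℂ)).const_mul (2 * b))
      (mul_ne_zero (mul_ne_zero two_ne_zero hb0) hs0)).comp_ofReal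
    convert! h using 1
    simp only [id, Pi.neg_apply]
    field_simp
    push_cast
    ring
  have hnorm : ∀ s : ℝ, 0 < s →
      ‖-Complex.exp (-b * (s : ℂ) ^ 2) / (2 * b * (s : ℂ))‖ ≤ 1 / (2 * ‖b‖) * s⁻¹ := by
    intro s hs0
    rw [norm_div, norm_neg, norm_mul, norm_mul, Complex.norm_real, Real.norm_of_nonneg hs0.le,
      Complex.norm_ofNat, ← one_div, one_div_mul_one_div]
    gcongr
    exact hle s
  have hlim : Tendsto (fun s : ℝ => -Complex.exp (-b * (s : ℂ) ^ 2) / (2 * b * (s : ℂ)))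
      atTop (nhds 0) := by
    refine squeeze_zero_norm' ((eventually_gt_atTop 0).mono hnorm) ?_
    simpa using tendsto_inv_atTop_zero.const_mul (1 / (2 * ‖b‖))
  have h := integral_Ioi_of_hasDerivAt_of_tendsto' hd (hI1.add hI2) hlim
  rw [integral_add hI1 hI2, zero_sub, ← eq_sub_iff_add_eq] at h
  have h2 : ‖∫ s in Ioi R, Complex.exp (-b * (s : ℂ) ^ 2) / (2 * b * (s : ℂ) ^ 2)‖
      ≤ 1 / (2 * ‖b‖) * R⁻¹ := by
    refine (norm_integral_le_of_norm_le hsq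
      ((ae_restrict_mem measurableSet_Ioi).mono hbound)).trans_eq ?_
    rw [integral_const_mul, integral_Ioi_rpow_of_lt (by norm_num) hR]
    norm_num [Real.rpow_neg_one]
  rw [h]
  refine (norm_sub_le _ _).trans ?_
  rw [norm_neg]
  refine (add_le_add (hnorm R hR) h2).trans_eq ?_
  field_simp
  norm_num

/-- The `k`-th term of the series for `∫₀^∞ e^{−bs²} e^{−sx} ds`. -/
noncomputable def gaussianLaplaceTerm (b : ℂ) (x : ℝ) (k : ℕ) : ℂ :=
  (((-x) ^ k / (Nat.factorial k) : ℝ) : ℂ) * (1 / 2 * (Real.Gamma (((k : ℝ) + 1) / 2) : ℂ)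
    * b ^ ((-(((k : ℝ) + 1) / 2) : ℝ) : ℂ))

lemma norm_gaussianLaplaceTerm (b : ℂ) {x : ℝ} (hx : 0 ≤ x) (k : ℕ) :
    ‖gaussianLaplaceTerm b x k‖ = x ^ k / (Nat.factorial k) *
      (1 / 2 * Real.Gamma (((k : ℝ) + 1) / 2) * ‖b‖ ^ (-(((k : ℝ) + 1) / 2))) := by
  have hG : 0 ≤ Real.Gamma (((k : ℝ) + 1) / 2) := Real.Gamma_nonneg_of_nonneg (by positivity)
  rw [gaussianLaplaceTerm, norm_mul, norm_mul, norm_mul, Complex.norm_cpow_real,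
    Complex.norm_real, Complex.norm_real, Real.norm_of_nonneg hG, norm_div, norm_pow, norm_neg,
    Real.norm_of_nonneg hx]
  simp

lemma fresnelSeriesTerm_eq_gaussianLaplaceTerm {μ : ℝ} (hμ : 0 < μ) (x : ℝ) (k : ℕ) :
    fresnelSeriesTerm μ x k = gaussianLaplaceTerm (μ * -Complex.I) x k := by
  have hμ0 : (μ : ℂ) ≠ 0 := Complex.ofReal_ne_zero.mpr hμ.ne'
  have hI : -Complex.I ≠ 0 := neg_ne_zero.mpr Complex.I_ne_zero
  rw [fresnelSeriesTerm, gaussianLaplaceTerm, Complex.cpow_def_of_ne_zero (mul_ne_zero hμ0 hI),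
    Complex.log_ofReal_mul hμ hI, Complex.log_neg_I, add_mul, Complex.exp_add,
    Complex.ofReal_cpow hμ.le, Complex.cpow_def_of_ne_zero hμ0, Complex.ofReal_log hμ.le]
  have : -(Real.pi / 2 : ℂ) * Complex.I * ((-(((k : ℝ) + 1) / 2) : ℝ) : ℂ) =
      Complex.I * Real.pi * (((k : ℝ) + 1 : ℝ) : ℂ) / 4 := by push_cast; ring
  rw [this]
  ring

lemma sum_pow_div_factorial_le_exp {y : ℝ} (hy : 0 ≤ y) (S : Finset ℕ) :
    ∑ k ∈ S, y ^ k / (Nat.factorial k) ≤ Real.exp y := by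
  rw [Real.exp_eq_exp_ℝ, NormedSpace.exp_eq_tsum_div]
  exact (Real.summable_pow_div_factorial y).sum_le_tsum S fun k _ => by positivity

lemma summable_pow_div_factorial_mul_integral {b x : ℝ} (hb : 0 < b) (hx : 0 ≤ x) :
    Summable fun k : ℕ => x ^ k / (Nat.factorial k) *
      ∫ s in Ioi (0 : ℝ), s ^ k * Real.exp (-b * s ^ 2) := by
  refine summable_of_sum_le
    (c := ∫ s in Ioi (0 : ℝ), Real.exp (x ^ 2 / (2 * b)) * Real.exp (-(b / 2) * s ^ 2)) ?_ ?_
  · intro k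
    refine mul_nonneg (by positivity) (setIntegral_nonneg measurableSet_Ioi fun s hs => ?_)
    have : 0 < s := hs
    positivity
  · intro S
    have hI : ∀ k ∈ S, IntegrableOn (fun s : ℝ => x ^ k / (Nat.factorial k) *
        (s ^ k * Real.exp (-b * s ^ 2))) (Ioi 0) := fun k _ =>
      (integrableOn_pow_mul_exp_neg_mul_sq hb k).const_mul _
    simp_rw [← integral_const_mul]
    rw [← integral_finsetSum S hI]
    refine setIntegral_mono_on (integrable_finsetSum S hI)
      ((integrable_exp_neg_mul_sq (half_pos hb)).const_mul _).integrableOn measurableSet_Ioi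
      fun s hs => ?_
    have hs0 : 0 ≤ s := le_of_lt hs
    calc ∑ k ∈ S, x ^ k / (Nat.factorial k) * (s ^ k * Real.exp (-b * s ^ 2))
        = (∑ k ∈ S, (x * s) ^ k / (Nat.factorial k)) * Real.exp (-b * s ^ 2) := by
          rw [Finset.sum_mul]
          refine Finset.sum_congr rfl fun k _ => ?_
          rw [mul_pow]
          ring
      _ ≤ Real.exp (x * s) * Real.exp (-b * s ^ 2) := by
          gcongr
          exact sum_pow_div_factorial_le_exp (by positivity) S
      _ ≤ Real.exp (x ^ 2 / (2 * b)) * Real.exp (-(b / 2) * s ^ 2) := by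
          rw [← Real.exp_add, ← Real.exp_add, Real.exp_le_exp, ← sub_nonneg]
          have : x ^ 2 / (2 * b) + -(b / 2) * s ^ 2 - (x * s + -b * s ^ 2)
              = (x - b * s) ^ 2 / (2 * b) := by field_simp; ring
          rw [this]
          positivity

lemma summable_norm_gaussianLaplaceTerm {b : ℂ} (hb : b ≠ 0) {x : ℝ} (hx : 0 ≤ x) :
    Summable fun k => ‖gaussianLaplaceTerm b x k‖ := by
  have hbn : 0 < ‖b‖ := norm_pos_iff.mpr hb
  simpa only [norm_gaussianLaplaceTerm b hx, integral_pow_mul_exp_neg_mul_sq hbn]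
    using summable_pow_div_factorial_mul_integral hbn hx

lemma tsum_gaussianLaplaceTerm {b : ℂ} (hb : 0 < b.re) {x : ℝ} (hx : 0 ≤ x) :
    ∑' k, gaussianLaplaceTerm b x k =
      ∫ s in Ioi (0 : ℝ), Complex.exp (-b * (s : ℂ) ^ 2) * Complex.exp (-((s : ℂ) * (x : ℂ))) := by
  have hI : ∀ k : ℕ, IntegrableOn (fun s : ℝ => (((-x) ^ k / (Nat.factorial k) : ℝ) : ℂ) *
      ((s : ℂ) ^ k * Complex.exp (-b * (s : ℂ) ^ 2))) (Ioi 0) := fun k =>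
    (integrableOn_pow_mul_cexp_neg_mul_sq hb k).const_mul _
  have hsum : Summable fun k : ℕ => ∫ s in Ioi (0 : ℝ), ‖(((-x) ^ k / (Nat.factorial k) : ℝ) : ℂ) *
      ((s : ℂ) ^ k * Complex.exp (-b * (s : ℂ) ^ 2))‖ := by
    refine (summable_pow_div_factorial_mul_integral hb hx).congr fun k => ?_
    rw [← integral_const_mul]
    refine setIntegral_congr_fun measurableSet_Ioi fun s hs => ?_
    rw [norm_mul, norm_pow_mul_cexp_neg_mul_sq b k (le_of_lt hs), Complex.norm_real, norm_div,
      norm_pow, norm_neg, Real.norm_of_nonneg hx]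
    simp
  have h := integral_tsum_of_summable_integral_norm hI hsum
  simp_rw [integral_const_mul, integral_pow_mul_cexp_neg_mul_sq hb] at h
  refine h.trans (setIntegral_congr_fun measurableSet_Ioi fun s _ => ?_)
  have hexp : Complex.exp (-((s : ℂ) * (x : ℂ))) =
      ∑' k : ℕ, (-((s : ℂ) * (x : ℂ))) ^ k / (Nat.factorial k) := by
    rw [Complex.exp_eq_exp_ℂ, NormedSpace.exp_eq_tsum_div]
  rw [hexp, ← tsum_mul_left]
  refine tsum_congr fun k => ?_
  rw [← mul_neg, mul_pow]
  push_cast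
  ring

/-- The Abel regularisation `ε − iμ` of the purely imaginary Gaussian parameter `−iμ`. -/
noncomputable def regularizedParameter (μ ε : ℝ) : ℂ := ε + μ * -Complex.I

lemma regularizedParameter_re (μ ε : ℝ) : (regularizedParameter μ ε).re = ε := by
  simp [regularizedParameter]

lemma tendsto_regularizedParameter (μ : ℝ) :
    Tendsto (regularizedParameter μ) (nhdsWithin 0 (Ioi 0)) (nhds (μ * -Complex.I)) := by
  have h : Continuous (regularizedParameter μ) := by unfold regularizedParameter; fun_prop
  simpa [ContinuousWithinAt, regularizedParameter] using
    h.continuousWithinAt (s := Ioi 0) (x := 0)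

lemma le_norm_regularizedParameter (μ ε : ℝ) : μ ≤ ‖regularizedParameter μ ε‖ := by
  refine (le_abs_self μ).trans ?_
  simpa [regularizedParameter] using Complex.abs_im_le_norm (regularizedParameter μ ε)

lemma tendsto_tsum_gaussianLaplaceTerm {μ x : ℝ} (hμ : 0 < μ) (hx : 0 ≤ x) :
    Tendsto (fun ε : ℝ => ∑' k, gaussianLaplaceTerm (regularizedParameter μ ε) x k)
      (nhdsWithin 0 (Ioi 0)) (nhds (∑' k, fresnelSeriesTerm μ x k)) := by
  have hμ0 : (μ : ℂ) ≠ 0 := Complex.ofReal_ne_zero.mpr hμ.ne'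
  refine tendsto_tsum_of_dominated_convergence
    (summable_norm_gaussianLaplaceTerm hμ0 hx) (fun k => ?_) (.of_forall fun ε k => ?_)
  · rw [fresnelSeriesTerm_eq_gaussianLaplaceTerm hμ]
    refine ((Tendsto.cpow (tendsto_regularizedParameter μ) tendsto_const_nhds ?_).const_mul
      _).const_mul _
    right
    simpa using hμ.ne'
  · rw [norm_gaussianLaplaceTerm _ hx, norm_gaussianLaplaceTerm _ hx, Complex.norm_real,
      Real.norm_of_nonneg hμ.le]
    have hG : 0 ≤ Real.Gamma (((k : ℝ) + 1) / 2) := Real.Gamma_nonneg_of_nonneg (by positivity)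
    have := Real.rpow_le_rpow_of_nonpos hμ (le_norm_regularizedParameter μ ε)
      (z := -(((k : ℝ) + 1) / 2)) (neg_nonpos.mpr (by positivity))
    gcongr

lemma tendsto_cexp_regularizedParameter (μ s : ℝ) :
    Tendsto (fun ε : ℝ => Complex.exp (-regularizedParameter μ ε * (s : ℂ) ^ 2))
      (nhdsWithin 0 (Ioi 0)) (nhds (Complex.exp (Complex.I * (μ : ℂ) * (s : ℂ) ^ 2))) := by
  have h := ((tendsto_regularizedParameter μ).neg.mul_const ((s : ℂ) ^ 2)).cexp
  convert! h using 3
  ring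

lemma norm_cexp_regularizedParameter_le (μ s : ℝ) {ε : ℝ} (hε : 0 < ε) :
    ‖Complex.exp (-regularizedParameter μ ε * (s : ℂ) ^ 2)‖ ≤ 1 := by
  rw [norm_cexp_neg_mul_sq, regularizedParameter_re, Real.exp_le_one_iff]
  nlinarith [mul_nonneg hε.le (sq_nonneg s)]

lemma tsum_fresnelSeriesTerm_of_pos {μ x : ℝ} (hμ : 0 < μ) (hx : 0 < x) :
    ∑' k, fresnelSeriesTerm μ x k = ∫ s in Ioi (0 : ℝ),
      Complex.exp (Complex.I * (μ : ℂ) * (s : ℂ) ^ 2) * Complex.exp (-((s : ℂ) * (x : ℂ))) := by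
  refine tendsto_nhds_unique_of_eventuallyEq (tendsto_tsum_gaussianLaplaceTerm hμ hx.le)
    (tendsto_integral_filter_of_dominated_convergence (fun s : ℝ => Real.exp (-x * s))
      (F := fun ε (s : ℝ) => Complex.exp (-regularizedParameter μ ε * (s : ℂ) ^ 2) *
        Complex.exp (-((s : ℂ) * (x : ℂ)))) (.of_forall fun ε => by fun_prop) ?_
      (integrableOn_exp_mul_Ioi (neg_neg_of_pos hx) 0)
      (.of_forall fun s => (tendsto_cexp_regularizedParameter μ s).mul_const _)) ?_
  · filter_upwards [self_mem_nhdsWithin] with ε hε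
    refine .of_forall fun s => ?_
    rw [norm_mul, Complex.norm_exp (-((s : ℂ) * (x : ℂ)))]
    have : (-((s : ℂ) * (x : ℂ))).re = -x * s := by simp [mul_comm]
    rw [this]
    exact mul_le_of_le_one_left (by positivity) (norm_cexp_regularizedParameter_le μ s hε)
  · filter_upwards [self_mem_nhdsWithin] with ε hε
    exact tsum_gaussianLaplaceTerm (by rwa [regularizedParameter_re]) hx.le

lemma norm_tsum_fresnelSeriesTerm_zero_sub_le {μ R : ℝ} (hμ : 0 < μ) (hR : 0 < R) :
    ‖(∫ s in (0 : ℝ)..R, Complex.exp (Complex.I * (μ : ℂ) * (s : ℂ) ^ 2)) -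
      ∑' k, fresnelSeriesTerm μ 0 k‖ ≤ 1 / (μ * R) := by
  have hlim : Tendsto (fun ε : ℝ => ∫ s in (0 : ℝ)..R,
      Complex.exp (-regularizedParameter μ ε * (s : ℂ) ^ 2)) (nhdsWithin 0 (Ioi 0))
      (nhds (∫ s in (0 : ℝ)..R, Complex.exp (Complex.I * (μ : ℂ) * (s : ℂ) ^ 2))) := by
    refine intervalIntegral.tendsto_integral_filter_of_dominated_convergence (fun _ => 1)
      (.of_forall fun ε => by fun_prop) ?_ intervalIntegrable_const
      (.of_forall fun s _ => tendsto_cexp_regularizedParameter μ s)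
    filter_upwards [self_mem_nhdsWithin] with ε hε
    exact .of_forall fun s _ => norm_cexp_regularizedParameter_le μ s hε
  refine le_of_tendsto (hlim.sub (tendsto_tsum_gaussianLaplaceTerm hμ le_rfl)).norm ?_
  filter_upwards [self_mem_nhdsWithin] with ε hε
  have hb : 0 < (regularizedParameter μ ε).re := by rwa [regularizedParameter_re]
  have hI := integrable_cexp_neg_mul_sq hb
  have hsplit := intervalIntegral.integral_interval_add_Ioi (a := 0) (b := R) hI.integrableOn
    hI.integrableOn
  have htsum := tsum_gaussianLaplaceTerm hb le_rfl
  simp only [Complex.ofReal_zero, mul_zero, neg_zero, Complex.exp_zero, mul_one] at htsum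
  rw [htsum, ← hsplit, sub_add_cancel_left, norm_neg]
  refine (norm_integral_Ioi_cexp_neg_mul_sq_le hb hR).trans ?_
  gcongr
  exact le_norm_regularizedParameter μ ε

/-- For `μ > 0` and `x ≥ 0`, the series `Σ_k ((−x)^k/k!)(1/2)Γ((k+1)/2)e^{iπ(k+1)/4}μ^{−(k+1)/2}`
converges absolutely and sums to `∫₀^∞ e^{iμs²}e^{−sx} ds` (an improper integral when `x = 0`). -/
theorem fresnel_exponential_series (μ x : ℝ) (hμ : 0 < μ) (hx : 0 ≤ x) :
    (Summable fun k : ℕ => ‖fresnelSeriesTerm μ x k‖) ∧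
    (0 < x →
      (∑' k : ℕ, fresnelSeriesTerm μ x k)
        = ∫ s in Set.Ioi (0 : ℝ),
            Complex.exp (Complex.I * (μ : ℂ) * (s : ℂ) ^ 2) * Complex.exp (-((s : ℂ) * (x : ℂ)))) ∧
    (x = 0 →
      Tendsto (fun R : ℝ => ∫ s in (0 : ℝ)..R, Complex.exp (Complex.I * (μ : ℂ) * (s : ℂ) ^ 2))
        atTop (nhds (∑' k : ℕ, fresnelSeriesTerm μ x k))) := by
  refine ⟨?_, tsum_fresnelSeriesTerm_of_pos hμ, ?_⟩
  · have hb : (μ : ℂ) * -Complex.I ≠ 0 :=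
      mul_ne_zero (Complex.ofReal_ne_zero.mpr hμ.ne') (neg_ne_zero.mpr Complex.I_ne_zero)
    simpa only [fresnelSeriesTerm_eq_gaussianLaplaceTerm hμ]
      using summable_norm_gaussianLaplaceTerm hb hx
  · rintro rfl
    rw [tendsto_iff_norm_sub_tendsto_zero]
    refine squeeze_zero' (.of_forall fun _ => norm_nonneg _)
      ((eventually_gt_atTop 0).mono fun R hR => norm_tsum_fresnelSeriesTerm_zero_sub_le hμ hR) ?_
    exact (tendsto_id.const_mul_atTop hμ).const_div_atTop 1
end

section
/- Define the entire function F(z) = Σ_{k=0}^∞ (−1)^k (Γ((k+1)/2)/k!) z^k. There is a constant C such that for every t ≥ 1, |F(t e^{iπ/4}) − 2 e^{−iπ/4}/t| ≤ C / t². -/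
open MeasureTheory Set Filter

/-- The entire function `F(z) = Σ_{k=0}^∞ (−1)^k (Γ((k+1)/2)/k!) z^k`. -/
noncomputable def kummerF (z : ℂ) : ℂ :=
  ∑' k : ℕ, ((-1 : ℂ) ^ k * ((Real.Gamma (((k : ℝ) + 1) / 2) / (Nat.factorial k) : ℝ) : ℂ)) * z ^ k

theorem integral_pow_mul_exp_neg_sq_Ioi (k : ℕ) :
    ∫ u in Ioi (0 : ℝ), u ^ k * Real.exp (-u ^ 2) = Real.Gamma (((k : ℝ) + 1) / 2) / 2 := by
  have h := integral_rpow_mul_exp_neg_rpow (p := 2) (q := k) two_pos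
    (by have : (0 : ℝ) ≤ k := k.cast_nonneg
        linarith)
  simp only [Real.rpow_natCast, Real.rpow_two] at h
  rw [h]
  ring

/-- The Laplace-type integral representation of `kummerF`. -/
theorem kummerF_eq_integral (z : ℂ) :
    kummerF z = 2 * ∫ u in Ioi (0 : ℝ), Complex.exp (-(u : ℂ) ^ 2) * Complex.exp (-z * u) := by
  have hexp (w : ℂ) (v : ℝ) : HasSum (fun k : ℕ => (w * v) ^ k / (Nat.factorial k : ℂ))
      (Complex.exp (w * v)) := by
    rw [Complex.exp_eq_exp_ℂ]
    exact NormedSpace.expSeries_div_hasSum_exp (w * v)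
  have hexpR (v : ℝ) : HasSum (fun k : ℕ => v ^ k / (Nat.factorial k : ℝ)) (Real.exp v) := by
    rw [Real.exp_eq_exp_ℝ]
    exact NormedSpace.expSeries_div_hasSum_exp v
  have key := hasSum_integral_of_dominated_convergence (μ := volume.restrict (Ioi (0 : ℝ)))
    (F := fun (k : ℕ) (u : ℝ) =>
      Complex.exp (-(u : ℂ) ^ 2) * ((-z * u) ^ k / (Nat.factorial k : ℂ)))
    (f := fun u : ℝ => Complex.exp (-(u : ℂ) ^ 2) * Complex.exp (-z * u))
    (fun k u => Real.exp (-u ^ 2) * ((‖z‖ * |u|) ^ k / (Nat.factorial k : ℝ)))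
    (fun k => (by fun_prop : Continuous _).aestronglyMeasurable)
    (fun k => ae_of_all _ fun u => by
      simp [Complex.norm_exp, ← Complex.ofReal_pow, mul_pow])
    (ae_of_all _ fun u => ((hexpR _).mul_left _).summable)
    (by
      have h : Integrable (fun u : ℝ => ‖Complex.exp (-1 * (u : ℂ) ^ 2 + ‖z‖ * u + 0)‖) :=
        (integrable_cexp_quadratic' (b := -1) (by simp) ‖z‖ 0).norm
      refine (h.integrableOn (s := Ioi 0)).congr_fun (fun u hu => ?_) measurableSet_Ioi
      simp only [((hexpR _).mul_left _).tsum_eq]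
      rw [abs_of_pos hu, ← Real.exp_add, Complex.norm_exp]
      simp [← Complex.ofReal_pow])
    (ae_of_all _ fun u => (hexp _ _).mul_left _)
  rw [← (key.mul_left 2).tsum_eq, kummerF]
  congr 1 with k
  have h (u : ℝ) : Complex.exp (-(u : ℂ) ^ 2) * ((-z * u) ^ k / (Nat.factorial k : ℂ)) =
      ((-1) ^ k * z ^ k / (Nat.factorial k : ℂ)) * ((u ^ k * Real.exp (-u ^ 2) : ℝ) : ℂ) := by
    push_cast
    rw [mul_pow, neg_pow z]
    ring
  simp only [h]
  rw [integral_const_mul, integral_complex_ofReal, integral_pow_mul_exp_neg_sq_Ioi]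
  push_cast
  ring

theorem norm_kummerF_sub_two_div_le {z : ℂ} (hz : 0 < z.re) :
    ‖kummerF z - 2 / z‖ ≤ 4 / z.re ^ 3 := by
  have hlap : ∫ u in Ioi (0 : ℝ), Complex.exp (-z * u) = 1 / z := by
    rw [integral_exp_mul_complex_Ioi (by simpa using hz)]
    simp [neg_div_neg_eq]
  have hexp_int : IntegrableOn (fun u : ℝ => Complex.exp (-z * u)) (Ioi 0) :=
    integrableOn_exp_mul_complex_Ioi (by simpa using hz) 0
  have hgauss (u : ℝ) : ‖Complex.exp (-(u : ℂ) ^ 2)‖ ≤ 1 := by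
    simp [Complex.norm_exp, ← Complex.ofReal_pow, sq_nonneg]
  have hprod_int : IntegrableOn
      (fun u : ℝ => Complex.exp (-(u : ℂ) ^ 2) * Complex.exp (-z * u)) (Ioi 0) :=
    hexp_int.bdd_mul (c := 1) (by fun_prop : Continuous _).aestronglyMeasurable (ae_of_all _ hgauss)
  have hmoment : ∫ u in Ioi (0 : ℝ), u ^ 2 * Real.exp (-(z.re * u)) = 2 / z.re ^ 3 := by
    have h := Real.integral_rpow_mul_exp_neg_mul_Ioi (a := 3) (r := z.re) (by norm_num) hz
    have h3 : Real.Gamma 3 = 2 := by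
      simp
    norm_num [h3] at h
    rw [h]
    field_simp
  have hmoment_int : IntegrableOn (fun u : ℝ => u ^ 2 * Real.exp (-(z.re * u))) (Ioi 0) := by
    by_contra hcon
    rw [integral_undef hcon] at hmoment
    have : 0 < 2 / z.re ^ 3 := by positivity
    linarith
  have hbound : ‖∫ u in Ioi (0 : ℝ),
      (Complex.exp (-(u : ℂ) ^ 2) * Complex.exp (-z * u) - Complex.exp (-z * u))‖
      ≤ 2 / z.re ^ 3 := by
    rw [← hmoment]
    refine norm_integral_le_of_norm_le hmoment_int (ae_of_all _ fun u => ?_)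
    rw [← sub_one_mul, norm_mul, Complex.norm_exp (-z * u)]
    have h1 : ‖Complex.exp (-(u : ℂ) ^ 2) - 1‖ ≤ u ^ 2 := by
      have : Complex.exp (-(u : ℂ) ^ 2) - 1 = ((Real.exp (-u ^ 2) - 1 : ℝ) : ℂ) := by
        push_cast
        rfl
      rw [this, Complex.norm_real, Real.norm_eq_abs, abs_le]
      have := Real.add_one_le_exp (-u ^ 2)
      have : Real.exp (-u ^ 2) ≤ 1 := Real.exp_le_one_iff.2 (by nlinarith)
      constructor <;> nlinarith
    have h2 : (-z * (u : ℂ)).re = -(z.re * u) := by simp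
    rw [h2]
    gcongr
  rw [integral_sub hprod_int hexp_int, hlap] at hbound
  rw [kummerF_eq_integral, show ∀ w : ℂ, 2 * w - 2 / z = 2 * (w - 1 / z) from fun w => by ring,
    norm_mul, Complex.norm_ofNat]
  calc _ ≤ 2 * (2 / z.re ^ 3) := by gcongr
    _ = 4 / z.re ^ 3 := by ring

/-- Along the ray `arg z = π/4`, `F(t e^{iπ/4}) = 2e^{−iπ/4}/t + O(1/t²)` as `t → ∞`. -/
theorem kummerF_ray_asymptotic :
    ∃ C : ℝ, ∀ t : ℝ, 1 ≤ t →
      ‖kummerF ((t : ℂ) * Complex.exp (Complex.I * (Real.pi : ℂ) / 4))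
          - 2 * Complex.exp (-(Complex.I) * (Real.pi : ℂ) / 4) / (t : ℂ)‖
        ≤ C / t ^ 2 := by
  have hc : 0 < Real.cos (Real.pi / 4) := by
    rw [Real.cos_pi_div_four]
    positivity
  refine ⟨4 / Real.cos (Real.pi / 4) ^ 3, fun t ht => ?_⟩
  have ht0 : 0 < t := by linarith
  have hre : ((t : ℂ) * Complex.exp (Complex.I * (Real.pi : ℂ) / 4)).re =
      t * Real.cos (Real.pi / 4) := by
    rw [show Complex.I * (Real.pi : ℂ) / 4 = ((Real.pi / 4 : ℝ) : ℂ) * Complex.I by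
      push_cast; ring, Complex.re_ofReal_mul, Complex.exp_ofReal_mul_I_re]
  have hlead : 2 * Complex.exp (-(Complex.I) * (Real.pi : ℂ) / 4) / (t : ℂ) =
      2 / ((t : ℂ) * Complex.exp (Complex.I * (Real.pi : ℂ) / 4)) := by
    rw [neg_mul, neg_div, Complex.exp_neg]
    ring
  rw [hlead]
  refine (norm_kummerF_sub_two_div_le (by rw [hre]; positivity)).trans ?_
  rw [hre, mul_pow, mul_comm (t ^ 3), ← div_div]
  gcongr
  norm_num
end

section
/- For every θ₀ > 0 there is a constant C = C(θ₀) such that for all μ ≥ 1 and all θ ≥ θ₀, |∫₀^∞ e^{iμs²} · θ/(s² + θ²) ds| ≤ C μ^{−1/2}. -/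
open MeasureTheory Set Filter

/-- The Fresnel phase has modulus one. -/
lemma norm_fresnel_phase (μ s : ℝ) : ‖Complex.exp (Complex.I * (μ : ℂ) * (s : ℂ) ^ 2)‖ = 1 := by
  have h : Complex.I * (μ : ℂ) * (s : ℂ) ^ 2 = ((μ * s ^ 2 : ℝ) : ℂ) * Complex.I := by
    push_cast; ring
  rw [h, Complex.norm_exp_ofReal_mul_I]

/-- The Poisson kernel is integrable. -/
lemma integrable_poisson_kernel {θ : ℝ} (hθ : 0 < θ) :
    Integrable fun s : ℝ => θ / (s ^ 2 + θ ^ 2) := by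
  convert (integrable_inv_one_add_sq.comp_div hθ.ne').const_mul θ⁻¹ using 2 with s
  have : s ^ 2 + θ ^ 2 ≠ 0 := by positivity
  have : 1 + (s / θ) ^ 2 ≠ 0 := by positivity
  field_simp
  ring

lemma integrable_fresnel_poisson {θ : ℝ} (hθ : 0 < θ) (μ : ℝ) :
    Integrable fun s : ℝ =>
      Complex.exp (Complex.I * (μ : ℂ) * (s : ℂ) ^ 2) * ((θ : ℂ) / ((s : ℂ) ^ 2 + (θ : ℂ) ^ 2)) := by
  have h := (integrable_poisson_kernel hθ).ofReal (𝕜 := ℂ)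
  push_cast at h
  refine h.bdd_mul (c := 1) ?_ (.of_forall fun s => (norm_fresnel_phase μ s).le)
  exact Continuous.aestronglyMeasurable (by fun_prop)

lemma norm_fresnel_poisson_le {θ : ℝ} (hθ : 0 < θ) (μ s : ℝ) :
    ‖Complex.exp (Complex.I * (μ : ℂ) * (s : ℂ) ^ 2) *
      ((θ : ℂ) / ((s : ℂ) ^ 2 + (θ : ℂ) ^ 2))‖ ≤ 1 / θ := by
  have h : (θ : ℂ) / ((s : ℂ) ^ 2 + (θ : ℂ) ^ 2) = ((θ / (s ^ 2 + θ ^ 2) : ℝ) : ℂ) := by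
    push_cast; rfl
  rw [norm_mul, norm_fresnel_phase, one_mul, h, Complex.norm_of_nonneg (by positivity),
    div_le_div_iff₀ (by positivity) hθ]
  nlinarith [sq_nonneg s]

/-- The oscillatory tail, away from the critical point, bounded by one integration by parts for an
amplitude `s * g s` with `g` decreasing to zero. -/
lemma norm_integral_Ioi_fresnel_phase_mul_le {μ a : ℝ} (hμ : 0 < μ) {g g' : ℝ → ℝ}
    (hg : ∀ s ∈ Ici a, HasDerivAt g (g' s) s) (hg' : ∀ s ∈ Ioi a, g' s ≤ 0)
    (hlim : Tendsto g atTop (nhds 0))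
    (hint : IntegrableOn (fun s : ℝ =>
      Complex.exp (Complex.I * (μ : ℂ) * (s : ℂ) ^ 2) * ((s * g s : ℝ) : ℂ)) (Ioi a)) :
    ‖∫ s in Ioi a, Complex.exp (Complex.I * (μ : ℂ) * (s : ℂ) ^ 2) * ((s * g s : ℝ) : ℂ)‖
      ≤ g a / μ := by
  set e : ℝ → ℂ := fun s => Complex.exp (Complex.I * (μ : ℂ) * (s : ℂ) ^ 2) with he
  have hnorm (s : ℝ) : ‖e s‖ = 1 := norm_fresnel_phase μ s
  have hecont : Continuous e := by fun_prop
  have hμ' : (μ : ℂ) ≠ 0 := by exact_mod_cast hμ.ne'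
  set c : ℂ := (2 * Complex.I * μ)⁻¹ with hc
  have hcnorm : ‖c‖ = (2 * μ)⁻¹ := by
    simp [hc, abs_of_pos hμ, mul_comm]
  have hg'int : IntegrableOn g' (Ioi a) := integrableOn_Ioi_deriv_of_nonpos' hg hg' hlim
  have hg'val : ∫ s in Ioi a, g' s = 0 - g a :=
    integral_Ioi_of_hasDerivAt_of_tendsto' hg hg'int hlim
  have hga : 0 ≤ g a := by
    have := setIntegral_nonpos (μ := volume) measurableSet_Ioi hg'
    linarith
  have heg' : IntegrableOn (fun s => e s * (g' s : ℂ)) (Ioi a) :=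
    hg'int.ofReal.bdd_mul (c := 1) hecont.aestronglyMeasurable (.of_forall fun s => (hnorm s).le)
  have hderiv : ∀ s ∈ Ici a, HasDerivAt (fun s : ℝ => c * (e s * (g s : ℂ)))
      (e s * ((s * g s : ℝ) : ℂ) + c * (e s * (g' s : ℂ))) s := by
    intro s hs
    have hphase : HasDerivAt (fun s : ℝ => Complex.I * (μ : ℂ) * (s : ℂ) ^ 2)
        (Complex.I * (μ : ℂ) * (2 * s)) s := by
      have := ((hasDerivAt_id s).ofReal_comp.pow 2).const_mul (Complex.I * (μ : ℂ))
      simpa using this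
    refine ((hphase.cexp.mul (hg s hs).ofReal_comp).const_mul c).congr_deriv ?_
    simp only [he, hc]
    push_cast
    field_simp
  have hF : Tendsto (fun s : ℝ => c * (e s * (g s : ℂ))) atTop (nhds 0) := by
    rw [tendsto_zero_iff_norm_tendsto_zero]
    simpa [hnorm] using (hlim.abs.const_mul ‖c‖)
  have hFTC := integral_Ioi_of_hasDerivAt_of_tendsto' hderiv (hint.add (heg'.const_mul c)) hF
  rw [integral_add hint (heg'.const_mul c), integral_const_mul] at hFTC
  have hbd : ‖∫ s in Ioi a, e s * (g' s : ℂ)‖ ≤ g a := by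
    refine (norm_integral_le_integral_norm _).trans ?_
    rw [setIntegral_congr_fun (g := fun s => -g' s) measurableSet_Ioi, integral_neg, hg'val]
    · simp
    · intro s hs
      simp [hnorm, abs_of_nonpos (hg' s hs)]
  rw [eq_sub_of_add_eq hFTC]
  calc ‖0 - c * (e a * (g a : ℂ)) - c * ∫ s in Ioi a, e s * (g' s : ℂ)‖
      ≤ ‖c * (e a * (g a : ℂ))‖ + ‖c * ∫ s in Ioi a, e s * (g' s : ℂ)‖ := by
        simpa using norm_sub_le (-(c * (e a * (g a : ℂ)))) (c * ∫ s in Ioi a, e s * (g' s : ℂ))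
    _ ≤ (2 * μ)⁻¹ * g a + (2 * μ)⁻¹ * g a := by
        rw [norm_mul, norm_mul, norm_mul, hnorm, hcnorm, one_mul, Complex.norm_of_nonneg hga]
        gcongr
    _ = g a / μ := by field_simp; ring

/-- Away from the critical point the Fresnel–Poisson integral is bounded by `1 / (θ μ a)`. -/
lemma norm_integral_Ioi_fresnel_poisson_le {μ θ a : ℝ} (hμ : 0 < μ) (hθ : 0 < θ) (ha : 0 < a) :
    ‖∫ s in Ioi a,
        Complex.exp (Complex.I * (μ : ℂ) * (s : ℂ) ^ 2) * ((θ : ℂ) / ((s : ℂ) ^ 2 + (θ : ℂ) ^ 2))‖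
      ≤ 1 / (θ * (μ * a)) := by
  let g : ℝ → ℝ := fun s => θ / (s * (s ^ 2 + θ ^ 2))
  have heq : EqOn (fun s : ℝ => Complex.exp (Complex.I * (μ : ℂ) * (s : ℂ) ^ 2) *
      ((θ : ℂ) / ((s : ℂ) ^ 2 + (θ : ℂ) ^ 2)))
      (fun s => Complex.exp (Complex.I * (μ : ℂ) * (s : ℂ) ^ 2) * ((s * g s : ℝ) : ℂ)) (Ioi a) := by
    intro s hs
    have hs0 : 0 < s := ha.trans hs
    have h : s * g s = θ / (s ^ 2 + θ ^ 2) := by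
      simp only [g]; field_simp
    simp only [h]
    push_cast
    rfl
  have hderiv : ∀ s ∈ Ici a,
      HasDerivAt g (-(θ * (3 * s ^ 2 + θ ^ 2)) / (s * (s ^ 2 + θ ^ 2)) ^ 2) s := by
    intro s hs
    have hs0 : 0 < s := ha.trans_le hs
    have hden := (hasDerivAt_id s).mul (((hasDerivAt_id s).pow 2).add_const (θ ^ 2))
    refine ((hasDerivAt_const s θ).div hden ?_).congr_deriv ?_
    · change s * (s ^ 2 + θ ^ 2) ≠ 0
      positivity
    · simp
      ring
  have hlim : Tendsto g atTop (nhds 0) := by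
    refine Tendsto.const_div_atTop ?_ θ
    exact tendsto_id.atTop_mul_atTop₀
      (tendsto_atTop_add_const_right _ _ (tendsto_pow_atTop two_ne_zero))
  rw [setIntegral_congr_fun measurableSet_Ioi heq]
  refine (norm_integral_Ioi_fresnel_phase_mul_le hμ hderiv (fun s _ => ?_) hlim
    ((integrable_fresnel_poisson hθ μ).integrableOn.congr_fun heq measurableSet_Ioi)).trans ?_
  · exact div_nonpos_of_nonpos_of_nonneg (neg_nonpos.2 (by positivity)) (by positivity)
  · rw [div_div, div_le_div_iff₀ (by positivity) (by positivity)]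
    have : 0 < μ * a ^ 3 := by positivity
    nlinarith

/-- Stationary-phase bound `|∫₀^∞ e^{iμs²} θ/(s² + θ²) ds| ≤ C μ^{−1/2}` for `μ ≥ 1`,
uniformly for `θ` bounded away from `0`. -/
theorem fresnel_poisson_stationary_bound (θ₀ : ℝ) (hθ₀ : 0 < θ₀) :
    ∃ C : ℝ, ∀ μ θ : ℝ, 1 ≤ μ → θ₀ ≤ θ →
      ‖∫ s in Set.Ioi (0 : ℝ),
          Complex.exp (Complex.I * (μ : ℂ) * (s : ℂ) ^ 2) * ((θ : ℂ) / ((s : ℂ) ^ 2 + (θ : ℂ) ^ 2))‖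
        ≤ C * μ ^ (-(1/2) : ℝ) := by
  refine ⟨2 / θ₀, fun μ θ hμ hθ => ?_⟩
  have hμ0 : 0 < μ := by linarith
  have hθ0 : 0 < θ := hθ₀.trans_le hθ
  set a : ℝ := μ ^ (-(1/2) : ℝ) with ha_def
  have ha : 0 < a := Real.rpow_pos_of_pos hμ0 _
  have haa : μ * a * a = 1 := by
    rw [mul_assoc, ha_def, ← Real.rpow_add hμ0]
    norm_num [Real.rpow_neg_one, hμ0.ne']
  have hint := integrable_fresnel_poisson hθ0 μ
  rw [← Ioc_union_Ioi_eq_Ioi ha.le, setIntegral_union (Ioc_disjoint_Ioi le_rfl) measurableSet_Ioi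
    hint.integrableOn hint.integrableOn]
  have hnear := norm_setIntegral_le_of_norm_le_const (μ := volume) (s := Ioc 0 a) (by simp)
    (fun s _ => norm_fresnel_poisson_le hθ0 μ s)
  rw [Real.volume_real_Ioc_of_le ha.le, sub_zero] at hnear
  have hfar := norm_integral_Ioi_fresnel_poisson_le hμ0 hθ0 ha
  have hinv : 1 / (θ * (μ * a)) = 1 / θ * a := by
    rw [div_eq_iff (by positivity)]
    field_simp
    linarith
  calc _ ≤ 1 / θ * a + 1 / θ * a := (norm_add_le _ _).trans (add_le_add hnear (hinv ▸ hfar))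
    _ = 2 / θ * a := by ring
    _ ≤ 2 / θ₀ * a := by gcongr
end

section
/- Fix δ > 0, and let G(r,r',θ) = (r² + r'² − 2 r r' cos θ)^{1/2}. There exist ε₀ > 0 and c > 0, depending only on δ, with the following property: for all r₁, r₂, r̃₂ > 0 with r₁ + r₂ ∈ [δ/4, 4δ] and r₁ + r̃₂ ∈ [δ/4, 4δ], and all θ, θ₁, θ₂ ∈ ℝ with θ₁ − θ ∈ [π − 2ε₀, π] and θ₂ − θ ∈ [π − 2ε₀, π], the phase Ψ(θ) = G(r₁, r₂, θ₂ − θ) − G(r₁, r̃₂, θ₁ − θ) satisfies |∂_θ Ψ(θ)| + |∂²_θ Ψ(θ)| ≥ c r₁² |r₂ − r̃₂|. -/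
open MeasureTheory Set Filter

/-- `G(r,r',θ) = (r² + r'² − 2rr' cos θ)^{1/2}`, the Euclidean distance between the points
with polar coordinates `(r,0)` and `(r',θ)`. -/
noncomputable def Gdist (r r' θ : ℝ) : ℝ :=
  Real.sqrt (r ^ 2 + r' ^ 2 - 2 * r * r' * Real.cos θ)

open Topology

lemma Gdist_radicand_pos {r s x : ℝ} (hr : 0 < r) (hs : 0 < s) (hx : Real.cos x < 0) :
    0 < r ^ 2 + s ^ 2 - 2 * r * s * Real.cos x := by
  have : 0 < r * s * (-Real.cos x) := mul_pos (mul_pos hr hs) (neg_pos.2 hx)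
  nlinarith [pow_pos hr 2, pow_pos hs 2]

lemma Gdist_pos {r s x : ℝ} (hr : 0 < r) (hs : 0 < s) (hx : Real.cos x < 0) :
    0 < Gdist r s x :=
  Real.sqrt_pos.2 (Gdist_radicand_pos hr hs hx)

lemma Gdist_sq {r s x : ℝ} (hr : 0 < r) (hs : 0 < s) (hx : Real.cos x < 0) :
    Gdist r s x ^ 2 = r ^ 2 + s ^ 2 - 2 * r * s * Real.cos x :=
  Real.sq_sqrt (Gdist_radicand_pos hr hs hx).le

/-- The distance from the origin to the line through the points with polar coordinates
`(r,0)` and `(s,x)`. -/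
noncomputable def lineHeight (r s x : ℝ) : ℝ := r * s * Real.sin x / Gdist r s x

/-- The distance from the point `(r,0)` to the foot of the perpendicular dropped from the origin
onto the line through `(r,0)` and `(s,x)`. -/
noncomputable def footDist (r s x : ℝ) : ℝ := (r ^ 2 - r * s * Real.cos x) / Gdist r s x

lemma Gdist_comm (r s x : ℝ) : Gdist r s x = Gdist s r x := by
  unfold Gdist; congr 1; ring

lemma lineHeight_comm (r s x : ℝ) : lineHeight r s x = lineHeight s r x := by
  unfold lineHeight; rw [Gdist_comm, mul_comm r s]

lemma footDist_pos {r s x : ℝ} (hr : 0 < r) (hs : 0 < s) (hx : Real.cos x < 0) :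
    0 < footDist r s x := by
  refine div_pos ?_ (Gdist_pos hr hs hx)
  have : 0 < r * s * (-Real.cos x) := mul_pos (mul_pos hr hs) (neg_pos.2 hx)
  nlinarith [pow_pos hr 2]

lemma footDist_add_footDist {r s x : ℝ} (hr : 0 < r) (hs : 0 < s) (hx : Real.cos x < 0) :
    footDist r s x + footDist s r x = Gdist r s x := by
  have hG := Gdist_pos hr hs hx
  unfold footDist
  rw [Gdist_comm s r, ← add_div, div_eq_iff hG.ne', ← sq, Gdist_sq hr hs hx]
  ring

lemma footDist_sq_add_lineHeight_sq {r s x : ℝ} (hr : 0 < r) (hs : 0 < s)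
    (hx : Real.cos x < 0) : footDist r s x ^ 2 + lineHeight r s x ^ 2 = r ^ 2 := by
  have hG := Gdist_pos hr hs hx
  unfold footDist lineHeight
  rw [div_pow, div_pow, ← add_div, div_eq_iff (pow_pos hG 2).ne', Gdist_sq hr hs hx]
  linear_combination r ^ 2 * s ^ 2 * Real.sin_sq_add_cos_sq x

lemma abs_lineHeight_le_footDist {r s x : ℝ} (hr : 0 < r) (hs : 0 < s) (hx : Real.cos x < 0)
    (hx' : 1 / 2 ≤ Real.cos x ^ 2) : |lineHeight r s x| ≤ footDist r s x := by
  have hG := Gdist_pos hr hs hx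
  refine abs_le_of_sq_le_sq ?_ (footDist_pos hr hs hx).le
  unfold footDist lineHeight
  rw [div_pow, div_pow]
  gcongr ?_ / _
  have h : 0 < r * s * (-Real.cos x) := mul_pos (mul_pos hr hs) (neg_pos.2 hx)
  have h2 : (r * s) ^ 2 * Real.sin x ^ 2 ≤ (r * s) ^ 2 * Real.cos x ^ 2 := by
    gcongr ?_ * ?_
    linarith [Real.sin_sq_add_cos_sq x]
  nlinarith [mul_pos h (pow_pos hr 2), pow_pos hr 4]

lemma hasDerivAt_Gdist_const_sub {r s β t : ℝ} (hr : 0 < r) (hs : 0 < s)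
    (hx : Real.cos (β - t) < 0) :
    HasDerivAt (fun t => Gdist r s (β - t)) (-lineHeight r s (β - t)) t := by
  have hcos : HasDerivAt (fun t => Real.cos (β - t)) (-Real.sin (β - t) * -1) t :=
    ((hasDerivAt_id t).const_sub β).cos
  have h := ((hcos.const_mul (2 * r * s)).const_sub (r ^ 2 + s ^ 2)).sqrt
    (Gdist_radicand_pos hr hs hx).ne'
  refine h.congr_deriv ?_
  have hG := (Gdist_pos hr hs hx).ne'
  unfold lineHeight
  unfold Gdist at hG ⊢
  field_simp

lemma hasDerivAt_neg_lineHeight_const_sub {r s β t : ℝ} (hr : 0 < r) (hs : 0 < s)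
    (hx : Real.cos (β - t) < 0) :
    HasDerivAt (fun t => -lineHeight r s (β - t))
      (-(footDist r s (β - t) * footDist s r (β - t) / Gdist r s (β - t))) t := by
  have hG := (Gdist_pos hr hs hx).ne'
  have hsin : HasDerivAt (fun t => Real.sin (β - t)) (Real.cos (β - t) * -1) t :=
    ((hasDerivAt_id t).const_sub β).sin
  refine (((hsin.const_mul (r * s)).div (hasDerivAt_Gdist_const_sub hr hs hx) hG).neg).congr_deriv ?_
  have h2 := Gdist_sq hr hs hx
  unfold lineHeight footDist
  rw [Gdist_comm s r]
  field_simp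
  rw [h2]
  linear_combination (-(r * s)) * Real.sin_sq_add_cos_sq (β - t)

/-- Two lines at distances `f`, `g` from the origin: the difference of the harmonic quantities
`p q / (p + q)` controls the difference of the radii `a`, `b` up to `|f - g|`. -/
lemma sq_mul_abs_sub_le_of_right_triangles {r a b f g p₁ q₁ p₂ q₂ : ℝ} (ha : 0 < a) (hb : 0 < b)
    (hp₁ : 0 < p₁) (hq₁ : 0 < q₁) (hp₂ : 0 < p₂) (hq₂ : 0 < q₂)
    (h₁r : p₁ ^ 2 + f ^ 2 = r ^ 2) (h₁a : q₁ ^ 2 + f ^ 2 = a ^ 2)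
    (h₂r : p₂ ^ 2 + g ^ 2 = r ^ 2) (h₂b : q₂ ^ 2 + g ^ 2 = b ^ 2)
    (hfp : |f| ≤ p₁) (hfq : |f| ≤ q₁) (hgp : |g| ≤ p₂) (hgq : |g| ≤ q₂) :
    r ^ 2 * |a - b| / 2 ≤ (p₁ + q₁) * (p₂ + q₂) *
      (|f - g| + |p₁ * q₁ / (p₁ + q₁) - p₂ * q₂ / (p₂ + q₂)|) := by
  have hp : r ^ 2 / 2 ≤ p₁ * p₂ := by
    have h1 : f ^ 2 ≤ p₁ ^ 2 := sq_le_sq' (abs_le.1 hfp).1 (abs_le.1 hfp).2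
    have h2 : g ^ 2 ≤ p₂ ^ 2 := sq_le_sq' (abs_le.1 hgp).1 (abs_le.1 hgp).2
    refine le_of_sq_le_sq ?_ (by positivity)
    calc (r ^ 2 / 2) ^ 2 = (r ^ 2 / 2) * (r ^ 2 / 2) := sq _
      _ ≤ p₁ ^ 2 * p₂ ^ 2 := by gcongr <;> linarith
      _ = (p₁ * p₂) ^ 2 := by ring
  have hqa : q₁ ≤ a := by nlinarith [sq_nonneg f]
  have hqb : q₂ ≤ b := by nlinarith [sq_nonneg g]
  have hfg : |f + g| ≤ |f| + |g| := abs_add_le f g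
  have key : (p₁ + q₁) * (p₂ + q₂) * (p₁ * q₁ / (p₁ + q₁) - p₂ * q₂ / (p₂ + q₂)) =
      p₁ * p₂ * ((a + b) / (q₁ + q₂)) * (a - b) -
      (p₁ * p₂ * ((f + g) / (q₁ + q₂)) + q₁ * q₂ * ((f + g) / (p₁ + p₂))) * (f - g) := by
    have e₁ : (a + b) / (q₁ + q₂) * (a - b) - (f + g) / (q₁ + q₂) * (f - g) = q₁ - q₂ := by
      field_simp
      linarith
    have e₂ : (f + g) / (p₁ + p₂) * (f - g) = p₂ - p₁ := by
      field_simp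
      linarith
    have e₃ : (p₁ + q₁) * (p₂ + q₂) * (p₁ * q₁ / (p₁ + q₁) - p₂ * q₂ / (p₂ + q₂)) =
        p₁ * p₂ * (q₁ - q₂) - q₁ * q₂ * (p₂ - p₁) := by
      field_simp
      ring
    rw [e₃, ← e₁, ← e₂]
    ring
  have hq' : |(f + g) / (q₁ + q₂)| ≤ 1 := by
    rw [abs_div, abs_of_pos (add_pos hq₁ hq₂)]
    exact div_le_one_of_le₀ (by linarith) (by positivity)
  have hp' : |(f + g) / (p₁ + p₂)| ≤ 1 := by
    rw [abs_div, abs_of_pos (add_pos hp₁ hp₂)]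
    exact div_le_one_of_le₀ (by linarith) (by positivity)
  have hmain : r ^ 2 * |a - b| / 2 ≤ |p₁ * p₂ * ((a + b) / (q₁ + q₂)) * (a - b)| := by
    have h1 : 1 ≤ (a + b) / (q₁ + q₂) := by
      rw [one_le_div (by positivity)]
      linarith
    rw [abs_mul, abs_of_pos (show 0 < p₁ * p₂ * ((a + b) / (q₁ + q₂)) by positivity)]
    calc r ^ 2 * |a - b| / 2 = (r ^ 2 / 2) * 1 * |a - b| := by ring
      _ ≤ _ := by gcongr
  have herr : |(p₁ * p₂ * ((f + g) / (q₁ + q₂)) + q₁ * q₂ * ((f + g) / (p₁ + p₂))) * (f - g)| ≤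
      (p₁ + q₁) * (p₂ + q₂) * |f - g| := by
    rw [abs_mul]
    gcongr
    calc _ ≤ |p₁ * p₂ * ((f + g) / (q₁ + q₂))| + |q₁ * q₂ * ((f + g) / (p₁ + p₂))| :=
          abs_add_le _ _
      _ = p₁ * p₂ * |(f + g) / (q₁ + q₂)| + q₁ * q₂ * |(f + g) / (p₁ + p₂)| := by
          rw [abs_mul (p₁ * p₂), abs_mul (q₁ * q₂), abs_of_pos (mul_pos hp₁ hp₂),
            abs_of_pos (mul_pos hq₁ hq₂)]
      _ ≤ p₁ * p₂ * 1 + q₁ * q₂ * 1 := by gcongr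
      _ ≤ (p₁ + q₁) * (p₂ + q₂) := by nlinarith [mul_pos hp₁ hq₂, mul_pos hq₁ hp₂]
  have hD : 0 < (p₁ + q₁) * (p₂ + q₂) := by positivity
  have htri := abs_sub_abs_le_abs_sub (p₁ * p₂ * ((a + b) / (q₁ + q₂)) * (a - b))
    ((p₁ * p₂ * ((f + g) / (q₁ + q₂)) + q₁ * q₂ * ((f + g) / (p₁ + p₂))) * (f - g))
  rw [← key, abs_mul ((p₁ + q₁) * (p₂ + q₂)), abs_of_pos hD] at htri
  rw [mul_add]
  linarith

lemma cos_neg_and_half_le_cos_sq {x : ℝ} (h : x ∈ Icc (Real.pi - Real.pi / 4) Real.pi) :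
    Real.cos x < 0 ∧ 1 / 2 ≤ Real.cos x ^ 2 := by
  have hpi := Real.pi_pos
  have h1 : √2 / 2 ≤ Real.cos (Real.pi - x) := by
    rw [← Real.cos_pi_div_four]
    exact Real.cos_le_cos_of_nonneg_of_le_pi (by linarith [h.2]) (by linarith) (by linarith [h.1])
  rw [Real.cos_pi_sub] at h1
  have h2 : (√2) ^ 2 = 2 := Real.sq_sqrt (by norm_num)
  have h3 : 0 < √2 := by positivity
  exact ⟨by linarith, by nlinarith⟩

lemma Gdist_le_add {r s x : ℝ} (hr : 0 < r) (hs : 0 < s) : Gdist r s x ≤ r + s := by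
  refine Real.sqrt_le_iff.2 ⟨by positivity, ?_⟩
  nlinarith [mul_pos hr hs, Real.neg_one_le_cos x]

/-- Lower bound `|∂_θ Ψ| + |∂²_θ Ψ| ≳ r₁²|r₂ − r̃₂|` for the `TT*` phase
`Ψ(θ) = G(r₁,r₂,θ₂−θ) − G(r₁,r̃₂,θ₁−θ)` when `θ₁ − θ, θ₂ − θ ∈ [π − 2ε₀, π]`. -/
theorem ttstar_phase_lower_bound (δ : ℝ) (hδ : 0 < δ) :
    ∃ ε₀ > (0 : ℝ), ∃ c > (0 : ℝ), ∀ r₁ r₂ r₂' θ θ₁ θ₂ : ℝ,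
      0 < r₁ → 0 < r₂ → 0 < r₂' →
      r₁ + r₂ ∈ Set.Icc (δ/4) (4*δ) → r₁ + r₂' ∈ Set.Icc (δ/4) (4*δ) →
      θ₁ - θ ∈ Set.Icc (Real.pi - 2*ε₀) Real.pi →
      θ₂ - θ ∈ Set.Icc (Real.pi - 2*ε₀) Real.pi →
      c * r₁ ^ 2 * |r₂ - r₂'| ≤
        |deriv (fun t => Gdist r₁ r₂ (θ₂ - t) - Gdist r₁ r₂' (θ₁ - t)) θ| +
        |deriv (deriv (fun t => Gdist r₁ r₂ (θ₂ - t) - Gdist r₁ r₂' (θ₁ - t))) θ| := by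
  refine ⟨Real.pi / 8, by positivity, 1 / (32 * δ ^ 2), by positivity, ?_⟩
  intro r a b θ θ₁ θ₂ hr ha hb hra hrb hθ₁ hθ₂
  rw [show 2 * (Real.pi / 8) = Real.pi / 4 by ring] at hθ₁ hθ₂
  obtain ⟨hc₁, hc₁'⟩ := cos_neg_and_half_le_cos_sq hθ₁
  obtain ⟨hc₂, hc₂'⟩ := cos_neg_and_half_le_cos_sq hθ₂
  have hnear : ∀ β, Real.cos (β - θ) < 0 → ∀ᶠ t in 𝓝 θ, Real.cos (β - t) < 0 := fun β hβ =>
    ContinuousAt.eventually_lt (f := fun t => Real.cos (β - t)) (by fun_prop)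
      continuousAt_const hβ
  have hderiv : deriv (fun t => Gdist r a (θ₂ - t) - Gdist r b (θ₁ - t)) =ᶠ[𝓝 θ]
      fun t => -lineHeight r a (θ₂ - t) - -lineHeight r b (θ₁ - t) := by
    filter_upwards [hnear θ₁ hc₁, hnear θ₂ hc₂] with t ht₁ ht₂
    exact ((hasDerivAt_Gdist_const_sub hr ha ht₂).sub (hasDerivAt_Gdist_const_sub hr hb ht₁)).deriv
  rw [hderiv.deriv_eq, hderiv.eq_of_nhds,
    ((hasDerivAt_neg_lineHeight_const_sub hr ha hc₂).fun_sub
      (hasDerivAt_neg_lineHeight_const_sub hr hb hc₁)).deriv]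
  have key := sq_mul_abs_sub_le_of_right_triangles ha hb
    (footDist_pos hr ha hc₂) (footDist_pos ha hr hc₂)
    (footDist_pos hr hb hc₁) (footDist_pos hb hr hc₁)
    (footDist_sq_add_lineHeight_sq hr ha hc₂)
    (lineHeight_comm r a _ ▸ footDist_sq_add_lineHeight_sq ha hr hc₂)
    (footDist_sq_add_lineHeight_sq hr hb hc₁)
    (lineHeight_comm r b _ ▸ footDist_sq_add_lineHeight_sq hb hr hc₁)
    (abs_lineHeight_le_footDist hr ha hc₂ hc₂')
    (lineHeight_comm r a _ ▸ abs_lineHeight_le_footDist ha hr hc₂ hc₂')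
    (abs_lineHeight_le_footDist hr hb hc₁ hc₁')
    (lineHeight_comm r b _ ▸ abs_lineHeight_le_footDist hb hr hc₁ hc₁')
  rw [footDist_add_footDist hr ha hc₂, footDist_add_footDist hr hb hc₁] at key
  have hG : Gdist r a (θ₂ - θ) * Gdist r b (θ₁ - θ) ≤ (4 * δ) * (4 * δ) :=
    mul_le_mul ((Gdist_le_add hr ha).trans hra.2) ((Gdist_le_add hr hb).trans hrb.2)
      (Gdist_pos hr hb hc₁).le (by positivity)
  have hbound := key.trans (mul_le_mul_of_nonneg_right hG (by positivity))
  rw [neg_sub_neg, neg_sub_neg, abs_sub_comm (lineHeight r b _), abs_sub_comm (_ / _)]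
  rw [show 1 / (32 * δ ^ 2) * r ^ 2 * |a - b| = r ^ 2 * |a - b| / 2 / (4 * δ * (4 * δ)) by
    field_simp; ring, div_le_iff₀' (by positivity)]
  exact hbound
end

section
/- Fix δ > 0, and let G(r₁,r₂,θ) = (r₁² + r₂² − 2 r₁ r₂ cos θ)^{1/2}. There exist ε₀ > 0 and C > 0, depending only on δ, such that for all r₁, r₂ > 0 with r₁ + r₂ ∈ [δ/4, 4δ] and all θ with |θ − π| ≤ ε₀: (i) ∂_θ G(r₁,r₂,θ) = r₁ r₂ sin θ / G(r₁,r₂,θ); (ii) |∂_θ G(r₁,r₂,θ) − (r₁ r₂/(r₁ + r₂)) sin θ| ≤ C (r₁ r₂)² |θ − π|³; and (iii) |∂²_θ G(r₁,r₂,θ) − (r₁ r₂/(r₁ + r₂)) cos θ| ≤ C (r₁ r₂)² (θ − π)². -/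
open MeasureTheory Set Filter

theorem hasDerivAt_Gdist {r r' θ : ℝ} (h : 0 < r ^ 2 + r' ^ 2 - 2 * r * r' * Real.cos θ) :
    HasDerivAt (Gdist r r') (r * r' * Real.sin θ / Gdist r r' θ) θ := by
  have h1 : HasDerivAt (fun x => r ^ 2 + r' ^ 2 - 2 * r * r' * Real.cos x)
      (2 * r * r' * Real.sin θ) θ := by
    simpa using ((Real.hasDerivAt_cos θ).const_mul (2 * r * r')).const_sub (r ^ 2 + r' ^ 2)
  have hG : Gdist r r' θ ≠ 0 := (Real.sqrt_pos.2 h).ne'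
  have h2 : HasDerivAt (Gdist r r') (2 * r * r' * Real.sin θ / (2 * Gdist r r' θ)) θ :=
    h1.sqrt h.ne'
  convert h2 using 1
  field_simp

theorem deriv_deriv_Gdist {r r' θ : ℝ} (h : 0 < r ^ 2 + r' ^ 2 - 2 * r * r' * Real.cos θ) :
    deriv (deriv (Gdist r r')) θ =
      r * r' * Real.cos θ / Gdist r r' θ
        - (r * r') ^ 2 * Real.sin θ ^ 2 / Gdist r r' θ ^ 3 := by
  have hev : deriv (Gdist r r') =ᶠ[nhds θ] fun x => r * r' * Real.sin x / Gdist r r' x := by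
    have hc : Continuous fun x => r ^ 2 + r' ^ 2 - 2 * r * r' * Real.cos x := by fun_prop
    filter_upwards [hc.continuousAt.eventually (lt_mem_nhds h)] with x hx
    exact (hasDerivAt_Gdist hx).deriv
  have hG : Gdist r r' θ ≠ 0 := (Real.sqrt_pos.2 h).ne'
  rw [hev.deriv_eq,
    (((Real.hasDerivAt_sin θ).const_mul (r * r')).fun_div (hasDerivAt_Gdist h) hG).deriv]
  field_simp

/-- Bound on `1/G - 1/s` when `G² = s² - 2pc` and `G ≥ s/2`. -/
theorem abs_inv_sub_inv_le_of_sq_eq {G s p c : ℝ} (hs : 0 < s) (hp : 0 ≤ p) (hc : 0 ≤ c)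
    (hG : s / 2 ≤ G) (h : G ^ 2 = s ^ 2 - 2 * p * c) :
    |1 / G - 1 / s| ≤ 4 * p * c / s ^ 3 := by
  have hG0 : 0 < G := by linarith
  have hpc : 0 ≤ p * c := mul_nonneg hp hc
  have key : 1 / G - 1 / s = 2 * (p * c) / (s * G * (s + G)) := by
    field_simp
    linarith
  rw [key, abs_of_nonneg (by positivity)]
  calc 2 * (p * c) / (s * G * (s + G)) ≤ 2 * (p * c) / (s * (s / 2) * s) := by
        gcongr
        linarith
    _ = 4 * p * c / s ^ 3 := by
        field_simp
        ring

/-- Near `θ = π`: the exact formula for `∂_θ G` and the approximations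
`∂_θ G ≈ (r₁r₂/(r₁+r₂)) sin θ` and `∂²_θ G ≈ (r₁r₂/(r₁+r₂)) cos θ` with the stated errors. -/
theorem Gdist_derivative_expansions (δ : ℝ) (hδ : 0 < δ) :
    ∃ ε₀ > (0 : ℝ), ∃ C > (0 : ℝ), ∀ r₁ r₂ θ : ℝ,
      0 < r₁ → 0 < r₂ → r₁ + r₂ ∈ Set.Icc (δ/4) (4*δ) → |θ - Real.pi| ≤ ε₀ →
      (deriv (Gdist r₁ r₂) θ = r₁ * r₂ * Real.sin θ / Gdist r₁ r₂ θ) ∧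
      |deriv (Gdist r₁ r₂) θ - (r₁ * r₂ / (r₁ + r₂)) * Real.sin θ|
        ≤ C * (r₁ * r₂) ^ 2 * |θ - Real.pi| ^ 3 ∧
      |deriv (deriv (Gdist r₁ r₂)) θ - (r₁ * r₂ / (r₁ + r₂)) * Real.cos θ|
        ≤ C * (r₁ * r₂) ^ 2 * (θ - Real.pi) ^ 2 := by
  refine ⟨1, one_pos, 640 / δ ^ 3, by positivity, ?_⟩
  intro r₁ r₂ θ h₁ h₂ hs hθ
  set t := θ - Real.pi with ht
  have hsin : |Real.sin θ| ≤ |t| := by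
    have : Real.sin θ = -Real.sin t := by rw [ht, Real.sin_sub_pi, neg_neg]
    rw [this, abs_neg]
    exact Real.abs_sin_le_abs
  have hcle : 1 + Real.cos θ ≤ t ^ 2 / 2 := by
    have h3 : Real.cos t = -Real.cos θ := by rw [ht, Real.cos_sub_pi]
    have := Real.one_sub_sq_div_two_le_cos (x := t)
    linarith
  have hc : 0 ≤ 1 + Real.cos θ := by linarith [Real.neg_one_le_cos θ]
  have ht1 : t ^ 2 ≤ 1 := (sq_le_one_iff_abs_le_one t).2 hθ
  obtain ⟨s, hsdef⟩ : ∃ s, s = r₁ + r₂ := ⟨_, rfl⟩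
  obtain ⟨p, hpdef⟩ : ∃ p, p = r₁ * r₂ := ⟨_, rfl⟩
  have hp : 0 < p := hpdef ▸ mul_pos h₁ h₂
  have hs0 : 0 < s := by rw [hsdef]; positivity
  have hps : 4 * p ≤ s ^ 2 := by
    rw [hpdef, hsdef]
    nlinarith [sq_nonneg (r₁ - r₂)]
  have hrad : r₁ ^ 2 + r₂ ^ 2 - 2 * r₁ * r₂ * Real.cos θ = s ^ 2 - 2 * p * (1 + Real.cos θ) := by
    rw [hpdef, hsdef]
    ring
  have hlow : (s / 2) ^ 2 ≤ r₁ ^ 2 + r₂ ^ 2 - 2 * r₁ * r₂ * Real.cos θ := by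
    rw [hrad]
    nlinarith
  have hpos : 0 < r₁ ^ 2 + r₂ ^ 2 - 2 * r₁ * r₂ * Real.cos θ := lt_of_lt_of_le (by positivity) hlow
  have hGs : s / 2 ≤ Gdist r₁ r₂ θ := Real.le_sqrt_of_sq_le hlow
  have hGsq : Gdist r₁ r₂ θ ^ 2 = s ^ 2 - 2 * p * (1 + Real.cos θ) := by
    rw [← hrad]
    exact Real.sq_sqrt hpos.le
  have hd := (hasDerivAt_Gdist hpos).deriv
  refine ⟨hd, ?_⟩
  rw [hd, deriv_deriv_Gdist hpos, ← hpdef, ← hsdef]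
  rw [← hsdef] at hs
  generalize Gdist r₁ r₂ θ = G at hGs hGsq
  have hG0 : 0 < G := by linarith
  have hinv : |1 / G - 1 / s| ≤ 2 * p * t ^ 2 / s ^ 3 :=
    calc |1 / G - 1 / s| ≤ 4 * p * (1 + Real.cos θ) / s ^ 3 :=
          abs_inv_sub_inv_le_of_sq_eq hs0 hp.le hc hGs hGsq
      _ ≤ 4 * p * (t ^ 2 / 2) / s ^ 3 := by gcongr
      _ = 2 * p * t ^ 2 / s ^ 3 := by ring
  have hsδ : 10 / s ^ 3 ≤ 640 / δ ^ 3 :=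
    calc 10 / s ^ 3 ≤ 10 / (δ / 4) ^ 3 := by
          gcongr
          exact hs.1
      _ = 640 / δ ^ 3 := by
          field_simp
          norm_num
  constructor
  · calc |p * Real.sin θ / G - p / s * Real.sin θ|
        = p * |Real.sin θ| * |1 / G - 1 / s| := by
          rw [← abs_of_pos hp, ← abs_mul, ← abs_mul, abs_of_pos hp]
          congr 1
          ring
      _ ≤ p * |t| * (2 * p * t ^ 2 / s ^ 3) := by gcongr
      _ = 2 / s ^ 3 * p ^ 2 * |t| ^ 3 := by
          rw [← sq_abs t]
          ring
      _ ≤ 10 / s ^ 3 * p ^ 2 * |t| ^ 3 := by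
          gcongr
          norm_num
      _ ≤ 640 / δ ^ 3 * p ^ 2 * |t| ^ 3 := by gcongr
  · have hfirst : |p * Real.cos θ * (1 / G - 1 / s)| ≤ p * 1 * (2 * p * t ^ 2 / s ^ 3) := by
      rw [abs_mul, abs_mul, abs_of_pos hp]
      gcongr
      exact Real.abs_cos_le_one θ
    have hsecond : |p ^ 2 * Real.sin θ ^ 2 / G ^ 3| ≤ p ^ 2 * t ^ 2 / (s / 2) ^ 3 := by
      rw [abs_of_nonneg (by positivity)]
      have := sq_le_sq.2 hsin
      gcongr
    calc |p * Real.cos θ / G - p ^ 2 * Real.sin θ ^ 2 / G ^ 3 - p / s * Real.cos θ|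
        = |p * Real.cos θ * (1 / G - 1 / s) - p ^ 2 * Real.sin θ ^ 2 / G ^ 3| := by
          congr 1
          ring
      _ ≤ p * 1 * (2 * p * t ^ 2 / s ^ 3) + p ^ 2 * t ^ 2 / (s / 2) ^ 3 :=
          (abs_sub _ _).trans (add_le_add hfirst hsecond)
      _ = 10 / s ^ 3 * p ^ 2 * t ^ 2 := by
          field_simp
          ring
      _ ≤ 640 / δ ^ 3 * p ^ 2 * t ^ 2 := by gcongr
end

section
/- There exists an infinitely differentiable function b : (0,∞) → ℂ such that for every ζ > 0, (1/π)∫₀^π cos(ζ sin t) dt = Re(e^{iζ} b(ζ)), and for every natural number k there is a constant C_k with |b^{(k)}(ζ)| ≤ C_k (1 + ζ)^{−k − 1/2} for all ζ > 0. -/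
open MeasureTheory Set Filter

open scoped ContDiff

/-- The oscillatory integral `∫ h(w) e^{-iζw²} dw`. -/
noncomputable def quadraticOscIntegral (h : ℝ → ℂ) (ζ : ℝ) : ℂ :=
  ∫ w : ℝ, h w * Complex.exp (-(Complex.I * ζ * w ^ 2))

lemma norm_cexp_neg_I_mul_sq (ζ w : ℝ) : ‖Complex.exp (-(Complex.I * ζ * w ^ 2))‖ = 1 := by
  have : -(Complex.I * ζ * w ^ 2) = ((-(ζ * w ^ 2) : ℝ) : ℂ) * Complex.I := by
    push_cast; ring
  rw [this, Complex.norm_exp_ofReal_mul_I]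

lemma continuous_cexp_neg_I_mul_sq (ζ : ℝ) :
    Continuous fun w : ℝ => Complex.exp (-(Complex.I * ζ * w ^ 2)) := by
  fun_prop

lemma hasDerivAt_cexp_neg_I_mul_sq (ζ w : ℝ) :
    HasDerivAt (fun w : ℝ => Complex.exp (-(Complex.I * ζ * w ^ 2)))
      (-(2 * Complex.I * ζ * w) * Complex.exp (-(Complex.I * ζ * w ^ 2))) w := by
  have h1 : HasDerivAt (fun w : ℝ => (w : ℂ)) 1 w := Complex.ofRealCLM.hasDerivAt
  refine HasDerivAt.congr_deriv ((((h1.fun_pow 2).const_mul (Complex.I * ζ)).fun_neg).cexp) ?_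
  push_cast
  ring

lemma integrable_mul_cexp_neg_I_mul_sq {h : ℝ → ℂ} (hc : Continuous h)
    (hs : HasCompactSupport h) (ζ : ℝ) :
    Integrable fun w : ℝ => h w * Complex.exp (-(Complex.I * ζ * w ^ 2)) :=
  (hc.mul (continuous_cexp_neg_I_mul_sq ζ)).integrable_of_hasCompactSupport hs.mul_right

lemma norm_quadraticOscIntegral_le (h : ℝ → ℂ) (ζ : ℝ) :
    ‖quadraticOscIntegral h ζ‖ ≤ ∫ w, ‖h w‖ := by
  refine (norm_integral_le_integral_norm _).trans_eq ?_
  simp [norm_cexp_neg_I_mul_sq]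

lemma hasDerivAt_quadraticOscIntegral {h : ℝ → ℂ} (hc : Continuous h)
    (hs : HasCompactSupport h) (ζ : ℝ) :
    HasDerivAt (quadraticOscIntegral h)
      (quadraticOscIntegral (fun w => -(Complex.I * w ^ 2) * h w) ζ) ζ := by
  have hc' : Continuous fun w : ℝ => -(Complex.I * (w : ℂ) ^ 2) * h w := by fun_prop
  have hs' : HasCompactSupport fun w : ℝ => -(Complex.I * (w : ℂ) ^ 2) * h w := hs.mul_left
  refine (hasDerivAt_integral_of_dominated_loc_of_deriv_le
    (F' := fun x w =>
      -(Complex.I * (w : ℂ) ^ 2) * h w * Complex.exp (-(Complex.I * x * w ^ 2)))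
    (bound := fun w : ℝ => ‖-(Complex.I * (w : ℂ) ^ 2) * h w‖) univ_mem
    (Eventually.of_forall fun x =>
      (integrable_mul_cexp_neg_I_mul_sq hc hs x).aestronglyMeasurable)
    (integrable_mul_cexp_neg_I_mul_sq hc hs ζ)
    (integrable_mul_cexp_neg_I_mul_sq hc' hs' ζ).aestronglyMeasurable
    (Eventually.of_forall fun w x _ => ?_)
    (hc'.integrable_of_hasCompactSupport hs').norm
    (Eventually.of_forall fun w x _ => ?_)).2
  · rw [norm_mul, norm_cexp_neg_I_mul_sq, mul_one]
  · have h1 : HasDerivAt (fun x : ℝ => (x : ℂ)) 1 x := Complex.ofRealCLM.hasDerivAt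
    refine HasDerivAt.congr_deriv
      ((((h1.const_mul Complex.I).mul_const ((w : ℂ) ^ 2)).fun_neg.cexp).const_mul (h w)) ?_
    ring

lemma iteratedDeriv_quadraticOscIntegral {h : ℝ → ℂ} (hc : Continuous h)
    (hs : HasCompactSupport h) (k : ℕ) :
    iteratedDeriv k (quadraticOscIntegral h) =
      quadraticOscIntegral fun w => (-(Complex.I * w ^ 2)) ^ k * h w := by
  induction k with
  | zero => simp
  | succ k ih =>
    rw [iteratedDeriv_succ, ih]
    ext ζ
    have hc' : Continuous fun w : ℝ => (-(Complex.I * (w : ℂ) ^ 2)) ^ k * h w := by fun_prop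
    rw [(hasDerivAt_quadraticOscIntegral hc' hs.mul_left ζ).deriv]
    simp only [← mul_assoc, ← pow_succ']

lemma contDiff_quadraticOscIntegral {h : ℝ → ℂ} (hc : Continuous h)
    (hs : HasCompactSupport h) : ContDiff ℝ ∞ (quadraticOscIntegral h) := by
  refine contDiff_of_differentiable_iteratedDeriv fun m _ => ?_
  rw [iteratedDeriv_quadraticOscIntegral hc hs]
  exact fun ζ =>
    (hasDerivAt_quadraticOscIntegral (by fun_prop) hs.mul_left ζ).differentiableAt

/-- Integration by parts against the phase `w²`. -/
lemma quadraticOscIntegral_pow_succ_mul {h : ℝ → ℂ} (hd : ContDiff ℝ ∞ h)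
    (hs : HasCompactSupport h) (k : ℕ) {ζ : ℝ} (hζ : ζ ≠ 0) :
    quadraticOscIntegral (fun w => (w : ℂ) ^ (2 * (k + 1)) * h w) ζ =
      (2 * Complex.I * ζ)⁻¹ * quadraticOscIntegral
        (fun w => (w : ℂ) ^ (2 * k) * ((2 * k + 1) * h w + w * deriv h w)) ζ := by
  have hc := hd.continuous
  have hc' : Continuous (deriv h) := hd.continuous_deriv (by simp)
  have hs' : HasCompactSupport (deriv h) := hs.deriv
  have hi₁ := integrable_mul_cexp_neg_I_mul_sq
    (h := fun w : ℝ => (w : ℂ) ^ (2 * (k + 1)) * h w) (by fun_prop) hs.mul_left ζ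
  have hi₂ := integrable_mul_cexp_neg_I_mul_sq
    (h := fun w : ℝ => (w : ℂ) ^ (2 * k) * ((2 * k + 1) * h w + w * deriv h w))
    (by fun_prop) (HasCompactSupport.mul_left (hs.mul_left.add hs'.mul_left)) ζ
  have hi₃ := integrable_mul_cexp_neg_I_mul_sq
    (h := fun w : ℝ => (w : ℂ) ^ (2 * k + 1) * h w) (by fun_prop) hs.mul_left ζ
  have key := integral_eq_zero_of_hasDerivAt_of_integrable
    (f := fun w : ℝ => (w : ℂ) ^ (2 * k + 1) * h w * Complex.exp (-(Complex.I * ζ * w ^ 2)))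
    (f' := fun w : ℝ =>
      (w : ℂ) ^ (2 * k) * ((2 * k + 1) * h w + w * deriv h w)
          * Complex.exp (-(Complex.I * ζ * w ^ 2))
        - (2 * Complex.I * ζ) * ((w : ℂ) ^ (2 * (k + 1)) * h w
          * Complex.exp (-(Complex.I * ζ * w ^ 2))))
    (fun w => by
      have h1 : HasDerivAt (fun w : ℝ => (w : ℂ)) 1 w := Complex.ofRealCLM.hasDerivAt
      have h2 : HasDerivAt h (deriv h w) w := (hd.differentiable (by simp) w).hasDerivAt
      refine HasDerivAt.congr_deriv (((h1.fun_pow (2 * k + 1)).fun_mul h2).fun_mul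
        (hasDerivAt_cexp_neg_I_mul_sq ζ w)) ?_
      push_cast [Nat.add_sub_cancel]
      ring)
    (hi₂.sub (hi₁.const_mul _)) hi₃
  rw [integral_sub hi₂ (hi₁.const_mul _), integral_const_mul, sub_eq_zero] at key
  have hne : 2 * Complex.I * (ζ : ℂ) ≠ 0 := by simp [hζ]
  rw [quadraticOscIntegral, quadraticOscIntegral, key, inv_mul_cancel_left₀ hne]

lemma integrable_inv_one_add_mul_sq {ζ : ℝ} (hζ : 0 < ζ) :
    Integrable fun w : ℝ => (1 + ζ * w ^ 2)⁻¹ := by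
  have := integrable_inv_one_add_sq.comp_mul_left' (R := √ζ) (by positivity)
  simpa [mul_pow, Real.sq_sqrt hζ.le] using this

lemma integral_inv_one_add_mul_sq {ζ : ℝ} (hζ : 0 < ζ) :
    ∫ w : ℝ, (1 + ζ * w ^ 2)⁻¹ = Real.pi / √ζ := by
  have := Measure.integral_comp_mul_left (fun x : ℝ => (1 + x ^ 2)⁻¹) (√ζ)
  simp only [mul_pow, Real.sq_sqrt hζ.le, integral_univ_inv_one_add_sq] at this
  rw [this, abs_of_pos (by positivity), smul_eq_mul, div_eq_inv_mul]

/-- The phase `e^{-iζw²}` is, up to an integrable error of size `(1 + ζw²)⁻¹`, a multiple of the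
derivative of `w (1 + ζw²)⁻¹ e^{-iζw²}`. -/
lemma hasDerivAt_mul_inv_one_add_mul_sq_mul_cexp {ζ : ℝ} (hζ : 0 < ζ) (w : ℝ) :
    HasDerivAt
      (fun w : ℝ => ((w * (1 + ζ * w ^ 2)⁻¹ : ℝ) : ℂ) * Complex.exp (-(Complex.I * ζ * w ^ 2)))
      ((((1 - ζ * w ^ 2) * (1 + ζ * w ^ 2)⁻¹ ^ 2 : ℝ) + 2 * Complex.I * ((1 + ζ * w ^ 2)⁻¹ : ℝ)
        - 2 * Complex.I) * Complex.exp (-(Complex.I * ζ * w ^ 2))) w := by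
  have hne : 1 + ζ * w ^ 2 ≠ 0 := by positivity
  have hneC : 1 + (ζ : ℂ) * (w : ℂ) ^ 2 ≠ 0 := by exact_mod_cast hne
  have h1 : HasDerivAt (fun w : ℝ => w * (1 + ζ * w ^ 2)⁻¹)
      ((1 - ζ * w ^ 2) * (1 + ζ * w ^ 2)⁻¹ ^ 2) w := by
    refine HasDerivAt.congr_deriv ((hasDerivAt_id' w).fun_mul
      (((((hasDerivAt_id' w).fun_pow 2).const_mul ζ).const_add 1).fun_inv hne)) ?_
    field_simp
    ring
  refine HasDerivAt.congr_deriv (h1.ofReal_comp.fun_mul (hasDerivAt_cexp_neg_I_mul_sq ζ w)) ?_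
  push_cast
  field_simp
  ring

lemma abs_mul_inv_one_add_mul_sq_le {ζ : ℝ} (hζ : 0 < ζ) (w : ℝ) :
    |w * (1 + ζ * w ^ 2)⁻¹| ≤ (√ζ)⁻¹ := by
  have hp : 0 < 1 + ζ * w ^ 2 := by positivity
  have hs : 0 < √ζ := by positivity
  rw [abs_mul, abs_of_pos (inv_pos.2 hp), ← div_eq_mul_inv, div_le_iff₀ hp, inv_mul_eq_div,
    le_div_iff₀ hs]
  nlinarith [sq_nonneg (|w| * √ζ - 1), Real.sq_sqrt hζ.le, sq_abs w, mul_pow |w| (√ζ) 2]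

/-- Van der Corput bound for the quadratic phase. -/
lemma exists_norm_quadraticOscIntegral_le_div_sqrt {h : ℝ → ℂ} (hd : ContDiff ℝ ∞ h)
    (hs : HasCompactSupport h) :
    ∃ C, ∀ ζ : ℝ, 0 < ζ → ‖quadraticOscIntegral h ζ‖ ≤ C / √ζ := by
  have hc := hd.continuous
  have hc' : Continuous (deriv h) := hd.continuous_deriv (by simp)
  have hs' : HasCompactSupport (deriv h) := hs.deriv
  obtain ⟨M, hM⟩ := hs.exists_bound_of_continuous hc
  refine ⟨((∫ w, ‖deriv h w‖) + 3 * M * Real.pi) / 2, fun ζ hζ => ?_⟩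
  have hpos (w : ℝ) : 0 < 1 + ζ * w ^ 2 := by positivity
  have hcinv : Continuous fun w : ℝ => (1 + ζ * w ^ 2)⁻¹ :=
    Continuous.inv₀ (by fun_prop) fun w => (hpos w).ne'
  set E : ℝ → ℂ := fun w => Complex.exp (-(Complex.I * ζ * w ^ 2)) with hE
  set A : ℝ → ℂ := fun w => ((w * (1 + ζ * w ^ 2)⁻¹ : ℝ) : ℂ)
  set B : ℝ → ℂ := fun w =>
    ((1 - ζ * w ^ 2) * (1 + ζ * w ^ 2)⁻¹ ^ 2 : ℝ) + 2 * Complex.I * ((1 + ζ * w ^ 2)⁻¹ : ℝ)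
  have hAc : Continuous A := Complex.continuous_ofReal.comp (continuous_id.mul hcinv)
  have hBc : Continuous B := by
    refine (Complex.continuous_ofReal.comp ?_).add
      (continuous_const.mul (Complex.continuous_ofReal.comp hcinv))
    exact Continuous.mul (by fun_prop) (hcinv.pow 2)
  have hBle (w : ℝ) : ‖B w‖ ≤ 3 * (1 + ζ * w ^ 2)⁻¹ := by
    have h1 : |(1 - ζ * w ^ 2) * (1 + ζ * w ^ 2)⁻¹ ^ 2| ≤ (1 + ζ * w ^ 2)⁻¹ := by
      rw [abs_mul, abs_of_pos (pow_pos (inv_pos.2 (hpos w)) 2),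
        sq (1 + ζ * w ^ 2)⁻¹, ← mul_assoc]
      refine mul_le_of_le_one_left (inv_pos.2 (hpos w)).le ?_
      rw [← div_eq_mul_inv, div_le_one (hpos w), abs_le]
      constructor <;> nlinarith [mul_nonneg hζ.le (sq_nonneg w)]
    refine (norm_add_le _ _).trans ?_
    rw [norm_mul, Complex.norm_real, Complex.norm_real, Real.norm_eq_abs, Real.norm_eq_abs,
      abs_of_pos (inv_pos.2 (hpos w))]
    simp only [norm_mul, Complex.norm_I, Complex.norm_ofNat]
    linarith
  have hi₀ := integrable_mul_cexp_neg_I_mul_sq hc hs ζ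
  have hi₁ := integrable_mul_cexp_neg_I_mul_sq (h := fun w => deriv h w * A w)
    (by fun_prop) hs'.mul_right ζ
  have hi₂ := integrable_mul_cexp_neg_I_mul_sq (h := fun w => h w * B w)
    (by fun_prop) hs.mul_right ζ
  have hi₃ := integrable_mul_cexp_neg_I_mul_sq (h := fun w => h w * A w)
    (by fun_prop) hs.mul_right ζ
  have key := integral_eq_zero_of_hasDerivAt_of_integrable
    (f := fun w : ℝ => h w * A w * E w)
    (f' := fun w : ℝ => deriv h w * A w * E w + h w * B w * E w
      - 2 * Complex.I * (h w * E w))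
    (fun w => by
      have h2 : HasDerivAt h (deriv h w) w := (hd.differentiable (by simp) w).hasDerivAt
      have h3 := h2.fun_mul (hasDerivAt_mul_inv_one_add_mul_sq_mul_cexp hζ w)
      simp only [← mul_assoc (h _)] at h3
      refine h3.congr_deriv ?_
      change deriv h w * (A w * E w) + h w * (B w - 2 * Complex.I) * E w = _
      ring)
    ((hi₁.add hi₂).sub (hi₀.const_mul _)) hi₃
  have hadd : ∫ w, (deriv h w * A w * E w + h w * B w * E w) =
      (∫ w, deriv h w * A w * E w) + ∫ w, h w * B w * E w := integral_add hi₁ hi₂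
  rw [integral_sub (f := fun w => deriv h w * A w * E w + h w * B w * E w)
    (hi₁.add hi₂) (hi₀.const_mul _), integral_const_mul, sub_eq_zero, hadd] at key
  have hn₁ : ‖∫ w, deriv h w * A w * E w‖ ≤ (∫ w, ‖deriv h w‖) * (√ζ)⁻¹ := by
    rw [← integral_mul_const]
    refine norm_integral_le_of_norm_le
      ((hc'.integrable_of_hasCompactSupport hs').norm.mul_const _) (Eventually.of_forall fun w => ?_)
    rw [norm_mul, norm_mul, norm_cexp_neg_I_mul_sq, mul_one, Complex.norm_real]
    gcongr
    exact abs_mul_inv_one_add_mul_sq_le hζ w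
  have hn₂ : ‖∫ w, h w * B w * E w‖ ≤ 3 * M * (Real.pi / √ζ) := by
    rw [← integral_inv_one_add_mul_sq hζ, ← integral_const_mul]
    refine norm_integral_le_of_norm_le
      ((integrable_inv_one_add_mul_sq hζ).const_mul _) (Eventually.of_forall fun w => ?_)
    rw [norm_mul, norm_mul, norm_cexp_neg_I_mul_sq, mul_one]
    calc ‖h w‖ * ‖B w‖ ≤ M * (3 * (1 + ζ * w ^ 2)⁻¹) :=
          mul_le_mul (hM w) (hBle w) (norm_nonneg _) ((norm_nonneg _).trans (hM w))
      _ = 3 * M * (1 + ζ * w ^ 2)⁻¹ := by ring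
  have hn : 2 * ‖quadraticOscIntegral h ζ‖ ≤
      (∫ w, ‖deriv h w‖) * (√ζ)⁻¹ + 3 * M * (Real.pi / √ζ) := by
    have : 2 * ‖quadraticOscIntegral h ζ‖ = ‖2 * Complex.I * ∫ w, h w * E w‖ := by
      simp [quadraticOscIntegral, hE]
    rw [this, ← key]
    exact (norm_add_le _ _).trans (add_le_add hn₁ hn₂)
  calc ‖quadraticOscIntegral h ζ‖
      ≤ ((∫ w, ‖deriv h w‖) * (√ζ)⁻¹ + 3 * M * (Real.pi / √ζ)) / 2 := by linarith
    _ = _ := by ring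

lemma exists_norm_quadraticOscIntegral_pow_mul_le (k : ℕ) {h : ℝ → ℂ} (hd : ContDiff ℝ ∞ h)
    (hs : HasCompactSupport h) :
    ∃ C, ∀ ζ : ℝ, 0 < ζ →
      ‖quadraticOscIntegral (fun w => (w : ℂ) ^ (2 * k) * h w) ζ‖ ≤ C / (ζ ^ k * √ζ) := by
  induction k generalizing h with
  | zero => simpa using exists_norm_quadraticOscIntegral_le_div_sqrt hd hs
  | succ k ih =>
    have hd' : ContDiff ℝ ∞ fun w : ℝ => (2 * k + 1) * h w + w * deriv h w :=
      (contDiff_const.mul hd).add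
        (Complex.ofRealCLM.contDiff.mul (contDiff_infty_iff_deriv.1 hd).2)
    obtain ⟨C, hC⟩ := ih hd' (hs.mul_left.add hs.deriv.mul_left)
    refine ⟨C / 2, fun ζ hζ => ?_⟩
    rw [quadraticOscIntegral_pow_succ_mul hd hs k hζ.ne', norm_mul]
    have : ‖(2 * Complex.I * (ζ : ℂ))⁻¹‖ = (2 * ζ)⁻¹ := by simp [abs_of_pos hζ]
    rw [this]
    calc _ ≤ (2 * ζ)⁻¹ * (C / (ζ ^ k * √ζ)) := by gcongr; exact hC ζ hζ
      _ = _ := by field_simp; ring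

lemma exists_norm_iteratedDeriv_quadraticOscIntegral_le {h : ℝ → ℂ} (hd : ContDiff ℝ ∞ h)
    (hs : HasCompactSupport h) (k : ℕ) :
    ∃ C : ℝ, ∀ ζ : ℝ, 0 < ζ →
      ‖iteratedDeriv k (quadraticOscIntegral h) ζ‖ ≤ C * (1 + ζ) ^ (-(k : ℝ) - 1 / 2) := by
  rw [iteratedDeriv_quadraticOscIntegral hd.continuous hs]
  have hd' : ContDiff ℝ ∞ fun w => (-Complex.I) ^ k * h w := contDiff_const.mul hd
  obtain ⟨C, hC⟩ := exists_norm_quadraticOscIntegral_pow_mul_le k hd' hs.mul_left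
  have heq : (fun w : ℝ => (-(Complex.I * (w : ℂ) ^ 2)) ^ k * h w) =
      fun w : ℝ => (w : ℂ) ^ (2 * k) * ((-Complex.I) ^ k * h w) := by
    ext w
    rw [← neg_mul, mul_pow, pow_mul]
    ring
  set D : ℝ := ∫ w : ℝ, ‖(w : ℂ) ^ (2 * k) * ((-Complex.I) ^ k * h w)‖
  have hD : 0 ≤ D := integral_nonneg fun _ => norm_nonneg _
  have hC0 : 0 ≤ C := by simpa using (norm_nonneg _).trans (hC 1 one_pos)
  refine ⟨(C + D) * 2 ^ ((k : ℝ) + 1 / 2), fun ζ hζ => ?_⟩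
  rw [heq]
  set N := ‖quadraticOscIntegral (fun w : ℝ => (w : ℂ) ^ (2 * k) * ((-Complex.I) ^ k * h w)) ζ‖
  have hexp : -(k : ℝ) - 1 / 2 = -((k : ℝ) + 1 / 2) := by ring
  rw [hexp, Real.rpow_neg (by positivity), ← div_eq_mul_inv, le_div_iff₀ (by positivity)]
  rcases le_total ζ 1 with h1 | h1
  · have hN : N ≤ C + D := (norm_quadraticOscIntegral_le _ ζ).trans (by linarith)
    gcongr
    linarith
  · have hN : N ≤ C / ζ ^ ((k : ℝ) + 1 / 2) := by
      rw [Real.rpow_add hζ, Real.rpow_natCast, ← Real.sqrt_eq_rpow]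
      exact hC ζ hζ
    calc N * (1 + ζ) ^ ((k : ℝ) + 1 / 2)
        ≤ C / ζ ^ ((k : ℝ) + 1 / 2) * (2 * ζ) ^ ((k : ℝ) + 1 / 2) := by
          gcongr
          linarith
      _ = C * 2 ^ ((k : ℝ) + 1 / 2) := by
          rw [Real.mul_rpow (by norm_num) hζ.le]
          field_simp
      _ ≤ _ := by gcongr; linarith

/-- The amplitude obtained from the cutoff `smoothTransition (1/2 + cos t)` under the change of
variables `w = √2 sin (t/2)`, for which `w² = 1 - cos t`. -/
noncomputable def besselAmplitude (w : ℝ) : ℝ :=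
  Real.smoothTransition (3 / 2 - w ^ 2) * (√2 / √(1 - w ^ 2 / 2))

lemma besselAmplitude_eq_zero {w : ℝ} (hw : 3 / 2 ≤ w ^ 2) : besselAmplitude w = 0 := by
  rw [besselAmplitude, Real.smoothTransition.zero_of_nonpos (by linarith), zero_mul]

lemma contDiff_besselAmplitude : ContDiff ℝ ∞ besselAmplitude := by
  rw [contDiff_iff_contDiffAt]
  intro w
  rcases lt_or_ge (w ^ 2) 2 with hw | hw
  · have hpos : 0 < 1 - w ^ 2 / 2 := by linarith
    have h1 : ContDiffAt ℝ ∞ (fun w : ℝ => √(1 - w ^ 2 / 2)) w :=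
      ContDiffAt.sqrt (by fun_prop) hpos.ne'
    have h2 : ContDiff ℝ ∞ fun w : ℝ => Real.smoothTransition (3 / 2 - w ^ 2) :=
      Real.smoothTransition.contDiff.comp (by fun_prop)
    exact h2.contDiffAt.mul (contDiffAt_const.div h1 (Real.sqrt_pos.2 hpos).ne')
  · have hev : besselAmplitude =ᶠ[nhds w] fun _ => 0 := by
      have : ∀ᶠ x : ℝ in nhds w, 3 / 2 < x ^ 2 :=
        (continuous_pow 2).continuousAt.eventually (lt_mem_nhds (by linarith))
      filter_upwards [this] with x hx using besselAmplitude_eq_zero hx.le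
    exact contDiffAt_const.congr_of_eventuallyEq hev

lemma abs_lt_sqrt_two_of_besselAmplitude_ne_zero {w : ℝ} (hw : besselAmplitude w ≠ 0) :
    |w| < √2 := by
  refine Real.lt_sqrt_of_sq_lt ?_
  rw [sq_abs]
  by_contra! h
  exact hw (besselAmplitude_eq_zero (by linarith))

lemma hasCompactSupport_besselAmplitude : HasCompactSupport besselAmplitude := by
  refine HasCompactSupport.of_support_subset_isCompact (isCompact_Icc (a := -√2) (b := √2)) ?_
  exact fun w hw => abs_le.1 (abs_lt_sqrt_two_of_besselAmplitude_ne_zero hw).le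

lemma besselAmplitude_comp_mul_deriv {t : ℝ} (ht : t ∈ Icc (-Real.pi) Real.pi) :
    besselAmplitude (√2 * Real.sin (t / 2)) * (√2 * (Real.cos (t / 2) / 2)) =
      Real.smoothTransition (1 / 2 + Real.cos t) := by
  have hsq : (√2 * Real.sin (t / 2)) ^ 2 = 1 - Real.cos t := by
    rw [mul_pow, Real.sq_sqrt (by norm_num), Real.sin_sq_eq_half_sub]
    ring_nf
  have hcos : 0 ≤ Real.cos (t / 2) :=
    Real.cos_nonneg_of_neg_pi_div_two_le_of_le (by linarith [ht.1]) (by linarith [ht.2])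
  have hsqrt : √(1 - (√2 * Real.sin (t / 2)) ^ 2 / 2) = Real.cos (t / 2) := by
    rw [hsq, ← Real.sqrt_sq hcos, Real.cos_sq (t / 2)]
    ring_nf
  have hcut : 3 / 2 - (√2 * Real.sin (t / 2)) ^ 2 = 1 / 2 + Real.cos t := by rw [hsq]; ring
  rw [besselAmplitude, hsqrt, hcut]
  rcases hcos.eq_or_lt with h0 | h0
  · have : Real.cos t = -1 := by
      have := Real.cos_sq (t / 2)
      rw [← h0, show 2 * (t / 2) = t by ring] at this
      linarith
    rw [Real.smoothTransition.zero_of_nonpos (by rw [this]; norm_num)]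
    ring
  · have h2 : √2 * √2 = 2 := Real.mul_self_sqrt (by norm_num)
    field_simp
    rw [sq, h2, mul_comm]

lemma smoothTransition_add_smoothTransition_one_sub (x : ℝ) :
    Real.smoothTransition x + Real.smoothTransition (1 - x) = 1 := by
  have h := (Real.smoothTransition.pos_denom x).ne'
  rw [Real.smoothTransition, Real.smoothTransition, sub_sub_cancel,
    add_comm (expNegInvGlue (1 - x)), ← add_div, div_self h]

lemma integral_cos_mul_sin_eq_integral_smoothTransition (ζ : ℝ) :
    ∫ t in (0 : ℝ)..Real.pi, Real.cos (ζ * Real.sin t) =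
      ∫ t in (-Real.pi)..Real.pi,
        Real.smoothTransition (1 / 2 + Real.cos t) * Real.cos (ζ * Real.cos t) := by
  set F : ℝ → ℝ := fun t =>
    Real.smoothTransition (1 / 2 + Real.cos t) * Real.cos (ζ * Real.cos t) with hF
  have hFc : Continuous F := by fun_prop
  have hper : Function.Periodic F (2 * Real.pi) := fun t => by simp [hF]
  have h1 := hper.intervalIntegral_add_eq (-Real.pi) (-(Real.pi / 2))
  rw [show -Real.pi + 2 * Real.pi = Real.pi by ring,
    show -(Real.pi / 2) + 2 * Real.pi = Real.pi / 2 + Real.pi by ring,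
    ← intervalIntegral.integral_add_adjacent_intervals
      (hFc.intervalIntegrable (-(Real.pi / 2)) (Real.pi / 2))
      (hFc.intervalIntegrable (Real.pi / 2) (Real.pi / 2 + Real.pi))] at h1
  have h2 : ∫ t in (Real.pi / 2)..(Real.pi / 2 + Real.pi), F t =
      ∫ t in (-(Real.pi / 2))..(Real.pi / 2), F (t + Real.pi) := by
    rw [intervalIntegral.integral_comp_add_right]
    congr 1
    ring
  have h3 : ∫ t in (0 : ℝ)..Real.pi, Real.cos (ζ * Real.sin t) =
      ∫ t in (-(Real.pi / 2))..(Real.pi / 2), Real.cos (ζ * Real.cos t) := by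
    have := intervalIntegral.integral_comp_sub_right (a := 0) (b := Real.pi)
      (fun t => Real.cos (ζ * Real.cos t)) (Real.pi / 2)
    simp only [Real.cos_sub_pi_div_two] at this
    rw [this]
    congr 1 <;> ring
  have hFc' : Continuous fun t => F (t + Real.pi) := by fun_prop
  rw [h1, h2, h3, ← intervalIntegral.integral_add (hFc.intervalIntegrable _ _)
    (hFc'.intervalIntegrable _ _)]
  refine intervalIntegral.integral_congr fun t _ => ?_
  have h4 := smoothTransition_add_smoothTransition_one_sub (1 / 2 + Real.cos t)
  rw [show 1 - (1 / 2 + Real.cos t) = 1 / 2 + -Real.cos t by ring] at h4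
  simp only [hF, Real.cos_add_pi, mul_neg, Real.cos_neg]
  rw [← add_mul, h4, one_mul]

lemma integral_cos_mul_sin_eq_integral_besselAmplitude (ζ : ℝ) :
    ∫ t in (0 : ℝ)..Real.pi, Real.cos (ζ * Real.sin t) =
      ∫ w : ℝ, besselAmplitude w * Real.cos (ζ * (1 - w ^ 2)) := by
  have hsupp : Function.support (fun w : ℝ => besselAmplitude w * Real.cos (ζ * (1 - w ^ 2))) ⊆
      Ioc (-√2) (√2) := by
    intro w hw
    have := abs_lt.1 (abs_lt_sqrt_two_of_besselAmplitude_ne_zero (left_ne_zero_of_mul hw))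
    exact ⟨this.1, this.2.le⟩
  have hc : Continuous fun w : ℝ => besselAmplitude w * Real.cos (ζ * (1 - w ^ 2)) :=
    contDiff_besselAmplitude.continuous.mul (by fun_prop)
  have hsub := intervalIntegral.integral_comp_mul_deriv (a := -Real.pi) (b := Real.pi)
    (f := fun t => √2 * Real.sin (t / 2)) (f' := fun t => √2 * (Real.cos (t / 2) / 2))
    (fun t _ => by
      refine HasDerivAt.congr_deriv ((((hasDerivAt_id' t).div_const 2).sin).const_mul √2) ?_
      ring)
    (by fun_prop) hc
  have hend : √2 * Real.sin (-Real.pi / 2) = -√2 := by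
    rw [neg_div, Real.sin_neg, Real.sin_pi_div_two]; ring
  simp only [hend, Real.sin_pi_div_two, mul_one] at hsub
  rw [intervalIntegral.integral_eq_integral_of_support_subset hsupp] at hsub
  rw [integral_cos_mul_sin_eq_integral_smoothTransition, ← hsub]
  refine intervalIntegral.integral_congr fun t ht => ?_
  rw [uIcc_of_le (by linarith [Real.pi_pos])] at ht
  have hsq : 1 - (√2 * Real.sin (t / 2)) ^ 2 = Real.cos t := by
    rw [mul_pow, Real.sq_sqrt (by norm_num), Real.sin_sq_eq_half_sub]
    ring_nf
  simp only [Function.comp, ← besselAmplitude_comp_mul_deriv ht, hsq]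
  ring

lemma re_cexp_mul_quadraticOscIntegral {a : ℝ → ℝ} (hc : Continuous a)
    (hs : HasCompactSupport a) (ζ : ℝ) :
    (Complex.exp (Complex.I * ζ) * quadraticOscIntegral (fun w => (a w : ℂ)) ζ).re =
      ∫ w : ℝ, a w * Real.cos (ζ * (1 - w ^ 2)) := by
  have hi := (integrable_mul_cexp_neg_I_mul_sq (h := fun w => (a w : ℂ)) (by fun_prop)
    (hs.comp_left Complex.ofReal_zero) ζ).const_mul (Complex.exp (Complex.I * ζ))
  rw [quadraticOscIntegral, ← integral_const_mul]
  refine (integral_re hi).symm.trans (integral_congr_ae (Eventually.of_forall fun w => ?_))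
  have : Complex.exp (Complex.I * ζ) * (a w * Complex.exp (-(Complex.I * ζ * w ^ 2))) =
      a w * Complex.exp (((ζ * (1 - w ^ 2) : ℝ) : ℂ) * Complex.I) := by
    rw [mul_left_comm, ← Complex.exp_add]
    congr 2
    push_cast
    ring
  simp only [this, RCLike.re_to_complex, Complex.re_ofReal_mul, Complex.exp_ofReal_mul_I_re]

/-- Stationary-phase description of the Bessel function `J₀`: there is a smooth symbol
`b` of order `−1/2` on `(0,∞)` with `J₀(ζ) = Re(e^{iζ} b(ζ))` and
`|b^{(k)}(ζ)| ≤ C_k (1+ζ)^{−k−1/2}`. -/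
theorem bessel_J0_symbol_representation :
    ∃ b : ℝ → ℂ, ContDiffOn ℝ (⊤ : ℕ∞) b (Set.Ioi 0) ∧
      (∀ ζ : ℝ, 0 < ζ →
        (1 / Real.pi) * (∫ t in (0 : ℝ)..Real.pi, Real.cos (ζ * Real.sin t))
          = (Complex.exp (Complex.I * (ζ : ℂ)) * b ζ).re) ∧
      (∀ k : ℕ, ∃ C : ℝ, ∀ ζ : ℝ, 0 < ζ →
        ‖iteratedDerivWithin k b (Set.Ioi 0) ζ‖ ≤ C * (1 + ζ) ^ (-(k : ℝ) - 1/2)) := by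
  have hs : HasCompactSupport fun w => (besselAmplitude w : ℂ) :=
    hasCompactSupport_besselAmplitude.comp_left Complex.ofReal_zero
  have hd : ContDiff ℝ ∞ fun w => (besselAmplitude w : ℂ) :=
    Complex.ofRealCLM.contDiff.comp contDiff_besselAmplitude
  have hF := contDiff_quadraticOscIntegral hd.continuous hs
  refine ⟨fun ζ => ((1 / Real.pi : ℝ) : ℂ) *
    quadraticOscIntegral (fun w => (besselAmplitude w : ℂ)) ζ,
    (contDiff_const.mul hF).contDiffOn, fun ζ _ => ?_, fun k => ?_⟩
  · rw [mul_left_comm, Complex.re_ofReal_mul, re_cexp_mul_quadraticOscIntegral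
      contDiff_besselAmplitude.continuous hasCompactSupport_besselAmplitude,
      integral_cos_mul_sin_eq_integral_besselAmplitude]
  · obtain ⟨C, hC⟩ := exists_norm_iteratedDeriv_quadraticOscIntegral_le hd hs k
    refine ⟨1 / Real.pi * C, fun ζ hζ => ?_⟩
    rw [iteratedDerivWithin_of_isOpen isOpen_Ioi hζ,
      iteratedDeriv_const_mul_field, norm_mul, Complex.norm_real, Real.norm_eq_abs,
      abs_of_pos (by positivity), mul_assoc]
    gcongr
    exact hC ζ hζ
end
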